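/- arXiv:math/0502244 — 2 statements merged into one kernel-verified Lean document; each statement's English description precedes it below -/
import Mathlib

section
/- Let W be a vector space over ℂ and let V be a subspace of ℰ(W) such that every ordered sequence in V of length 2 or 3 is quasi compatible and V is closed. Let ψ(x), φ(x), θ(x) ∈ V and let f(x,y) be a nonzero polynomial such that f(x,y)φ(x)θ(y) ∈ Hom(W, W((x,y))) and f(x,y)f(x,z)f(y,z)ψ(x)φ(y)θ(z) ∈ Hom(W, W((x,y,z))). Then f(x+x₁, x) f(x+x₂, x) f(x+x₁, x+x₂) Y_ℰ(ψ(x), x₁) Y_ℰ(φ(x), x₂) θ(x) = ( f(y,x) f(z,x) f(y,z) ψ(y) φ(z) θ(x) )|_{y = x+x₁, z = x+x₂}. -/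
noncomputable section

open Classical

namespace NVA

/-! ### The space ℰ(W) = Hom(W, W((x))), coefficient-indexed by modes:
`a w n` is the mode `a_n` applied to `w`, where `a(x)w = ∑ (a_n w) x^{-n-1}`.
Lower truncation of `a(x)w` in powers of `x` means `a_n w = 0` for `n` large. -/

variable (W : Type*) [AddCommGroup W] [Module ℂ W]

/-- `ℰ(W) = Hom(W, W((x)))` as a submodule of `Hom(W, W[[x^{±1}]])`. -/
def EWsub : Submodule ℂ (W →ₗ[ℂ] (ℤ → W)) where
  carrier := {a | ∀ w : W, ∃ N : ℤ, ∀ n : ℤ, N ≤ n → a w n = 0}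
  add_mem' := by
    intro a b ha hb w
    obtain ⟨N, hN⟩ := ha w
    obtain ⟨M, hM⟩ := hb w
    refine ⟨max N M, fun n hn => ?_⟩
    simp only [LinearMap.add_apply, Pi.add_apply,
      hN n (le_trans (le_max_left _ _) hn), hM n (le_trans (le_max_right _ _) hn), add_zero]
  zero_mem' := by intro w; exact ⟨0, fun n _ => rfl⟩
  smul_mem' := by
    intro c a ha w
    obtain ⟨N, hN⟩ := ha w
    exact ⟨N, fun n hn => by
      simp only [LinearMap.smul_apply, Pi.smul_apply, hN n hn, smul_zero]⟩

/-- The type `ℰ(W)`. -/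
abbrev EW := ↥(EWsub W)

variable {W}

/-- The mode function of an element of `ℰ(W)`. -/
def mf (a : EW W) : W → ℤ → W := fun w n => (a : W →ₗ[ℂ] (ℤ → W)) w n

/-- The identity operator `1_W`, as an element of `ℰ(W)`. -/
def oneE : EW W :=
  ⟨{ toFun := fun w n => if n = -1 then w else 0
     map_add' := by
       intro w w'; funext n; by_cases h : n = -1 <;> simp [h]
     map_smul' := by
       intro c w; funext n; by_cases h : n = -1 <;> simp [h] },
   fun w => ⟨0, fun n hn => if_neg (by omega)⟩⟩

/-- The generalized binomial coefficient `C(m, j)` for `m ∈ ℤ`, as a complex number. -/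
def binom (m : ℤ) (j : ℕ) : ℂ :=
  (∏ i ∈ Finset.range j, ((m : ℂ) - (i : ℂ))) / (j.factorial : ℂ)

/-- The coefficient of `x₁^m x₂^t` in `a(x₁) b(x₂) w`. -/
def Fab (a b : EW W) (w : W) (m t : ℤ) : W := mf a (mf b w (-t - 1)) (-m - 1)

/-- Multiplication of a two-variable family by a polynomial `p(x₁,x₂)`. -/
def mulPoly (p : MvPolynomial (Fin 2) ℂ) (F : ℤ → ℤ → W) : ℤ → ℤ → W :=
  fun m t => ∑ d ∈ p.support, MvPolynomial.coeff d p • F (m - d 0) (t - d 1)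

/-- A two-variable family lies in `W((x₁,x₂))` (jointly lower truncated). -/
def IsLaurent2 (F : ℤ → ℤ → W) : Prop :=
  ∃ N : ℤ, ∀ m t : ℤ, (m < N ∨ t < N) → F m t = 0

/-- Quasi compatibility of an ordered pair `(a(x), b(x))` in `ℰ(W)`:
`p(x₁,x₂) a(x₁) b(x₂) ∈ Hom(W, W((x₁,x₂)))` for some nonzero polynomial `p`. -/
def QCPair (a b : EW W) : Prop :=
  ∃ p : MvPolynomial (Fin 2) ℂ, p ≠ 0 ∧ ∀ w, IsLaurent2 (mulPoly p (Fab a b w))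

/-! ### Sequences -/

/-- The coefficient of `x₁^{k 1} ⋯ x_r^{k r}` in `ψ₁(x₁) ⋯ ψ_r(x_r) w`. -/
def seqCoeff : {r : ℕ} → (Fin r → EW W) → W → (Fin r → ℤ) → W
  | 0, _, w, _ => w
  | _ + 1, ψ, w, k => mf (ψ 0) (seqCoeff (Fin.tail ψ) w (Fin.tail k)) (-(k 0) - 1)

/-- The polynomial `∏_{1 ≤ i < j ≤ r} p(x_i, x_j)`. -/
def pairPoly (p : MvPolynomial (Fin 2) ℂ) (r : ℕ) : MvPolynomial (Fin r) ℂ :=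
  ∏ ij ∈ Finset.univ.filter (fun ij : Fin r × Fin r => ij.1 < ij.2),
    MvPolynomial.rename ![ij.1, ij.2] p

/-- Multiplication of an `r`-variable family by a polynomial in `r` variables. -/
def mulPolyN {r : ℕ} (P : MvPolynomial (Fin r) ℂ) (F : (Fin r → ℤ) → W) :
    (Fin r → ℤ) → W :=
  fun k => ∑ d ∈ P.support, MvPolynomial.coeff d P • F (fun i => k i - d i)

/-- An `r`-variable family lies in `W((x₁,…,x_r))`. -/
def IsLaurentN {r : ℕ} (F : (Fin r → ℤ) → W) : Prop :=
  ∃ N : ℤ, ∀ k : Fin r → ℤ, (∃ i, k i < N) → F k = 0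

/-- Quasi compatibility of an ordered sequence in `ℰ(W)`. -/
def QCSeq {r : ℕ} (ψ : Fin r → EW W) : Prop :=
  ∃ p : MvPolynomial (Fin 2) ℂ, p ≠ 0 ∧
    ∀ w, IsLaurentN (mulPolyN (pairPoly p r) (seqCoeff ψ w))

/-- Quasi compatibility of a subset of `ℰ(W)`. -/
def QCSet (S : Set (EW W)) : Prop :=
  ∀ (r : ℕ) (ψ : Fin r → EW W), (∀ i, ψ i ∈ S) → QCSeq ψ

/-! ### The vertex operation `Y_ℰ^{(α)}` -/

/-- `ℂ((x))`. -/
abbrev LC : Type := LaurentSeries ℂ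

/-- An iterated Laurent series field, e.g. `ℂ((x))((x₀))` (outer variable the second one). -/
abbrev K2 : Type := HahnSeries ℤ LC

/-- The outer variable of `K2`. -/
def xOuter : K2 := HahnSeries.single 1 1

/-- The inner variable of `K2`. -/
def xInner : K2 := HahnSeries.single 0 (HahnSeries.single 1 1)

/-- `α` times the inner variable of `K2`. -/
def xInnerC (c : ℂ) : K2 := HahnSeries.single 0 (HahnSeries.single 1 c)

/-- The polynomial `p(x₀ + α x, x)` as an element of `ℂ((x))((x₀))`
(outer variable `x₀`). -/
def qK (p : MvPolynomial (Fin 2) ℂ) (α : ℂ) : K2 :=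
  MvPolynomial.aeval ![xOuter + xInnerC α, xInner] p

/-- The expansion `ι_{x,x₀} (p(x₀ + α x, x)^{-1}) ∈ ℂ((x))((x₀))`. -/
def qInv (p : MvPolynomial (Fin 2) ℂ) (α : ℂ) : K2 := (qK p α)⁻¹

/-- The coefficient of `x₀^j x^t` in `(p(x₁,x) a(x₁) b(x) w)|_{x₁ = αx + x₀}`,
expanding via `(αx+x₀)^m = ∑_{j≥0} C(m,j) α^{m-j} x^{m-j} x₀^j`. -/
def substYE (α : ℂ) (p : MvPolynomial (Fin 2) ℂ) (a b : EW W) (w : W)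
    (j : ℕ) (t : ℤ) : W :=
  ∑ᶠ m : ℤ, (binom m j * α ^ (m - (j : ℤ))) • mulPoly p (Fab a b w) m (t - m + j)

/-- The coefficient of `x₀^J x^T` in
`ι_{x,x₀}(p(x₀+αx,x)^{-1}) ⬝ (p(x₁,x)a(x₁)b(x)w)|_{x₁ = αx+x₀}`. -/
def fullYE (α : ℂ) (p : MvPolynomial (Fin 2) ℂ) (a b : EW W) (w : W)
    (J T : ℤ) : W :=
  ∑ᶠ s : ℤ × ℤ, (((qInv p α).coeff s.1).coeff s.2) •
    (if 0 ≤ J - s.1 then substYE α p a b w (J - s.1).toNat (T - s.2) else 0)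

/-- The raw mode family of `Y_ℰ^{(α)}(a(x), x₀) b(x)`; `rawYE α a b n w m` is the mode
`m` of the element `a(x)_{(α,n)} b(x)` applied to `w`.  (Defined using a choice of
polynomial from quasi compatibility; by the general theory the value does not depend
on the choice.) -/
def rawYE (α : ℂ) (a b : EW W) (n : ℤ) (w : W) (m : ℤ) : W :=
  if h : QCPair a b then fullYE α h.choose a b w (-n - 1) (-m - 1) else 0

/-- `a(x)_{(α,n)} b(x)`, as an element of `ℰ(W)` whenever the raw family is realized
by one (which is the case for any quasi compatible pair). -/
def YEa (α : ℂˣ) (a b : EW W) (n : ℤ) : EW W :=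
  if h : ∃ c : EW W, ∀ w m, mf c w m = rawYE (α : ℂ) a b n w m then h.choose else 0

/-- `a(x)_n b(x) = a(x)_{(1,n)} b(x)`. -/
def YE (a b : EW W) (n : ℤ) : EW W := YEa 1 a b n

end NVA

namespace NVA

variable {W : Type*} [AddCommGroup W] [Module ℂ W]

/-- Submodules of `ℰ(W)` are `ℂ`-vector spaces (registered explicitly to assist
instance resolution). -/
noncomputable instance (V : Submodule ℂ (EW W)) : AddCommGroup ↥V :=
  @Submodule.addCommGroup ℂ (EW W) _ inferInstance inferInstance V

noncomputable instance (V : Submodule ℂ (EW W)) : Module ℂ ↥V :=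
  @Submodule.module ℂ (EW W) _ inferInstance inferInstance V

/-! ### Derivative and scaling operators on ℰ(W) -/

/-- `D = d/dx` on `ℰ(W)`: `(Da)_m = -m • a_{m-1}`. -/
def Dop (a : EW W) : EW W :=
  ⟨{ toFun := fun w m => (-m : ℂ) • mf a w (m - 1)
     map_add' := by intro w w'; funext m; simp [mf, map_add]
     map_smul' := by
       intro c w; funext m
       simp only [mf, map_smul, Pi.smul_apply, RingHom.id_apply]
       exact smul_comm _ _ _ },
   by
     intro w
     obtain ⟨N, hN⟩ := a.2 w
     exact ⟨N + 1, fun m hm => by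
       have : (a : W →ₗ[ℂ] (ℤ → W)) w (m - 1) = 0 := hN _ (by omega)
       simp [mf, this]⟩⟩

/-- `R_α : a(x) ↦ a(αx)`, on modes `(R_α a)_m = α^{-m-1} a_m`. -/
def RaE (α : ℂˣ) (a : EW W) : EW W :=
  ⟨{ toFun := fun w m => ((α : ℂ) ^ (-m - 1 : ℤ)) • mf a w m
     map_add' := by intro w w'; funext m; simp [mf, map_add]
     map_smul' := by
       intro c w; funext m
       simp only [mf, map_smul, Pi.smul_apply, RingHom.id_apply]
       exact smul_comm _ _ _ },
   by
     intro w
     obtain ⟨N, hN⟩ := a.2 w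
     exact ⟨N, fun m hm => by simp [mf, hN m hm]⟩⟩

/-! ### Nonlocal vertex algebras, modules and quasi modules -/

/-- The coefficient of `x₀^a x₂^b` in `Y₁(u, x₀+x₂) (Y₂(v,x₂) w)`, where
`(x₀+x₂)^m` is expanded in nonnegative powers of `x₂`. -/
def prodCE {V : Type*} (Yo Yi : V → W → ℤ → W) (u v : V) (w : W) (a b : ℤ) : W :=
  ∑ᶠ m : ℤ, if a ≤ m then
    binom m (m - a).toNat • Yo u (Yi v w (-(b - (m - a)) - 1)) (-m - 1) else 0

/-- The coefficient of `x₀^a x₂^b` in `Y₂(Y₁(u,x₀)v, x₂) w`. -/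
def assocCE {V : Type*} (Y1 : V → V → ℤ → V) (Y2 : V → W → ℤ → W)
    (u v : V) (w : W) (a b : ℤ) : W :=
  Y2 (Y1 u v (-a - 1)) w (-b - 1)

/-- Multiplication of a two-variable family (in `x₀, x₂`) by `f(x₀+x₂, x₂)` for a
polynomial `f`, expanding `(x₀+x₂)^d` in nonnegative powers of `x₂`. -/
def mulSubPoly (f : MvPolynomial (Fin 2) ℂ) (A : ℤ → ℤ → W) (a b : ℤ) : W :=
  ∑ d ∈ f.support, ∑ i ∈ Finset.range (d 0 + 1),
    (MvPolynomial.coeff d f * ((d 0).choose i : ℂ)) •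
      A (a - ((d 0 : ℤ) - i)) (b - i - (d 1 : ℤ))

/-- A nonlocal vertex algebra structure on a ℂ-vector space `V`:
a linear map `Y : V → ℰ(V) = Hom(V, V((x)))` and a vacuum vector `1` such that
`Y(1,x)v = v`, `Y(v,x)1 ∈ V[[x]]` with constant term `v`, and weak associativity
holds. -/
structure NLVA (V : Type*) [AddCommGroup V] [Module ℂ V] where
  Y : V →ₗ[ℂ] EW V
  one : V
  vac : ∀ (v : V) (n : ℤ), mf (Y one) v n = if n = -1 then v else 0
  creation0 : ∀ (v : V) (n : ℤ), 0 ≤ n → mf (Y v) one n = 0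
  creation1 : ∀ v : V, mf (Y v) one (-1) = v
  wassoc : ∀ u v w : V, ∃ l : ℕ, ∀ a b : ℤ,
    mulSubPoly (MvPolynomial.X 0 ^ l)
      (prodCE (fun x => mf (Y x)) (fun x => mf (Y x)) u v w) a b =
    mulSubPoly (MvPolynomial.X 0 ^ l)
      (assocCE (fun x y n => mf (Y x) y n) (fun x => mf (Y x)) u v w) a b

/-- The mode maps of a nonlocal vertex algebra: `Yf A u v n = u_n v`. -/
def Yf {V : Type*} [AddCommGroup V] [Module ℂ V] (A : NLVA V) : V → V → ℤ → V :=
  fun u v n => mf (A.Y u) v n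

/-- Mode maps of a linear map `V → ℰ(W)`. -/
def YWf {V : Type*} [AddCommGroup V] [Module ℂ V] (YW : V →ₗ[ℂ] EW W) :
    V → W → ℤ → W := fun v w n => mf (YW v) w n

/-- `(W, Y_W)` is a quasi module for the nonlocal vertex algebra `A` on `V`. -/
def IsQuasiModule {V : Type*} [AddCommGroup V] [Module ℂ V] (A : NLVA V)
    (YW : V →ₗ[ℂ] EW W) : Prop :=
  (∀ (w : W) (n : ℤ), mf (YW A.one) w n = if n = -1 then w else 0) ∧
  ∀ (u v : V) (w : W), ∃ f : MvPolynomial (Fin 2) ℂ, f ≠ 0 ∧ ∀ a b : ℤ,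
    mulSubPoly f (prodCE (YWf YW) (YWf YW) u v w) a b =
    mulSubPoly f (assocCE (Yf A) (YWf YW) u v w) a b

/-- `(W, Y_W)` is a module for the nonlocal vertex algebra `A` on `V`. -/
def IsModule {V : Type*} [AddCommGroup V] [Module ℂ V] (A : NLVA V)
    (YW : V →ₗ[ℂ] EW W) : Prop :=
  (∀ (w : W) (n : ℤ), mf (YW A.one) w n = if n = -1 then w else 0) ∧
  ∀ (u v : V) (w : W), ∃ l : ℕ, ∀ a b : ℤ,
    mulSubPoly (MvPolynomial.X 0 ^ l) (prodCE (YWf YW) (YWf YW) u v w) a b =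
    mulSubPoly (MvPolynomial.X 0 ^ l) (assocCE (Yf A) (YWf YW) u v w) a b

end NVA

namespace NVA

variable {W : Type*} [AddCommGroup W] [Module ℂ W]

/-- The polynomial `f(x+x₁, x) f(x+x₂, x) f(x+x₁, x+x₂)` in the variables
`(x, x₁, x₂) = (X 0, X 1, X 2)`. -/
def Gpoly (f : MvPolynomial (Fin 2) ℂ) : MvPolynomial (Fin 3) ℂ :=
  (MvPolynomial.aeval ![MvPolynomial.X 0 + MvPolynomial.X 1, MvPolynomial.X 0] f) *
  (MvPolynomial.aeval ![MvPolynomial.X 0 + MvPolynomial.X 2, MvPolynomial.X 0] f) *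
  (MvPolynomial.aeval
    ![MvPolynomial.X 0 + MvPolynomial.X 1, MvPolynomial.X 0 + MvPolynomial.X 2] f)

/-- The polynomial `f(x,y) f(x,z) f(y,z)` in the variables `(x, y, z)`. -/
def P3hyp (f : MvPolynomial (Fin 2) ℂ) : MvPolynomial (Fin 3) ℂ :=
  (MvPolynomial.rename ![0, 1] f) * (MvPolynomial.rename ![0, 2] f) *
    (MvPolynomial.rename ![1, 2] f)

/-- The polynomial `f(y,x) f(z,x) f(y,z)` in the variables `(y, z, x)`. -/
def P3con (f : MvPolynomial (Fin 2) ℂ) : MvPolynomial (Fin 3) ℂ :=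
  (MvPolynomial.rename ![0, 2] f) * (MvPolynomial.rename ![1, 2] f) *
    (MvPolynomial.rename ![0, 1] f)

/-! ### The action of polynomials on formal families -/

/-- The unit vector `e_i` of `ℤ^r`. -/
abbrev unitVec {r : ℕ} (i : Fin r) : Fin r → ℤ := Pi.single i 1

/-- Translations of an `r`-variable family by exponents of monomials. -/
def shiftHom (r : ℕ) (W : Type*) [AddCommGroup W] [Module ℂ W] :
    Multiplicative (Fin r →₀ ℕ) →* Module.End ℂ ((Fin r → ℤ) → W) where
  toFun d := LinearMap.funLeft ℂ W fun k i => k i - (d.toAdd i : ℤ)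
  map_one' := by ext F k; simp [LinearMap.funLeft_apply]
  map_mul' d e := by
    ext F k
    simp only [LinearMap.funLeft_apply, Module.End.mul_apply, toAdd_mul, Finsupp.add_apply]
    congr 1; funext i; push_cast; ring

/-- The action of `ℂ[x₁,…,x_r]` on `r`-variable families, as an algebra homomorphism. -/
def polyAct {r : ℕ} : MvPolynomial (Fin r) ℂ →ₐ[ℂ] Module.End ℂ ((Fin r → ℤ) → W) :=
  AddMonoidAlgebra.lift ℂ _ _ (shiftHom r W)

lemma mulPolyN_eq {r : ℕ} (P : MvPolynomial (Fin r) ℂ) (F : (Fin r → ℤ) → W) :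
    mulPolyN P F = polyAct P F := by
  funext k
  simp only [polyAct, AddMonoidAlgebra.lift_apply, Finsupp.sum, LinearMap.sum_apply,
    Finset.sum_apply, LinearMap.smul_apply, Pi.smul_apply]
  rfl

lemma mulPoly_eq (p : MvPolynomial (Fin 2) ℂ) (F : (Fin 2 → ℤ) → W) (m t : ℤ) :
    mulPoly p (fun m t => F ![m, t]) m t = polyAct p F ![m, t] := by
  rw [← mulPolyN_eq]
  refine Finset.sum_congr rfl fun d _ => ?_
  congr 1
  refine congrArg F (funext fun i => ?_)
  fin_cases i <;> rfl

@[simp] lemma polyAct_C {r : ℕ} (c : ℂ) (F : (Fin r → ℤ) → W) :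
    polyAct (MvPolynomial.C c) F = c • F := by
  rw [← MvPolynomial.algebraMap_eq, AlgHom.commutes, Module.algebraMap_end_apply]

@[simp] lemma polyAct_X {r : ℕ} (i : Fin r) (F : (Fin r → ℤ) → W) (k : Fin r → ℤ) :
    polyAct (MvPolynomial.X i) F k = F (k - unitVec i) := by
  have : polyAct (W := W) (MvPolynomial.X i : MvPolynomial (Fin r) ℂ) =
      shiftHom r W (Multiplicative.ofAdd (Finsupp.single i 1)) := by
    exact (AddMonoidAlgebra.lift_single _ _ _).trans (one_smul _ _)
  rw [this]
  simp only [shiftHom, MonoidHom.coe_mk, OneHom.coe_mk, LinearMap.funLeft_apply]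
  congr 1; funext j
  by_cases h : j = i
  · subst h; simp
  · simp [h]

lemma polyAct_add {r : ℕ} (P Q : MvPolynomial (Fin r) ℂ) (F : (Fin r → ℤ) → W) :
    polyAct (P + Q) F = polyAct P F + polyAct Q F := by
  rw [map_add, LinearMap.add_apply]

lemma polyAct_mul {r : ℕ} (P Q : MvPolynomial (Fin r) ℂ) (F : (Fin r → ℤ) → W) :
    polyAct (P * Q) F = polyAct P (polyAct Q F) := by
  rw [map_mul, Module.End.mul_apply]

lemma polyAct_comm {r : ℕ} (P Q : MvPolynomial (Fin r) ℂ) (F : (Fin r → ℤ) → W) :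
    polyAct P (polyAct Q F) = polyAct Q (polyAct P F) := by
  rw [← polyAct_mul, mul_comm, polyAct_mul]

/-- A class of families stable under linear combinations and translations is stable under the
action of polynomials. -/
lemma polyAct_mem {r : ℕ} (D : Submodule ℂ ((Fin r → ℤ) → W))
    (hX : ∀ F ∈ D, ∀ i, polyAct (MvPolynomial.X i) F ∈ D)
    (P : MvPolynomial (Fin r) ℂ) : ∀ F ∈ D, polyAct P F ∈ D := by
  induction P using MvPolynomial.induction_on with
  | C c => intro F hF; rw [polyAct_C]; exact D.smul_mem c hF
  | add p q hp hq => intro F hF; rw [polyAct_add]; exact D.add_mem (hp F hF) (hq F hF)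
  | mul_X p i hp => intro F hF; rw [polyAct_mul]; exact hp _ (hX F hF i)

/-- The values of `polyAct P F` on a set stable under lowering exponents depend only on the
values of `F` on that set. -/
lemma polyAct_congr {r : ℕ} {U : Set (Fin r → ℤ)} (hU : ∀ k ∈ U, ∀ i, k - unitVec i ∈ U)
    (P : MvPolynomial (Fin r) ℂ) : ∀ {F G : (Fin r → ℤ) → W}, Set.EqOn F G U →
      Set.EqOn (polyAct P F) (polyAct P G) U := by
  induction P using MvPolynomial.induction_on with
  | C c => intro F G h k hk; simp [h hk]
  | add p q hp hq =>
    intro F G h k hk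
    simp only [polyAct_add, Pi.add_apply, hp h hk, hq h hk]
  | mul_X p i hp =>
    intro F G h
    simp only [polyAct_mul]
    exact hp fun k hk => by simpa using h (hU k hk i)

/-- Restriction of families along a map that respects translations in the variables `e`. -/
lemma polyAct_comp {r s : ℕ} (e : Fin s → Fin r) (g : (Fin s → ℤ) → (Fin r → ℤ))
    (hg : ∀ j i, g (j - unitVec i) = g j - unitVec (e i))
    (P : MvPolynomial (Fin s) ℂ) : ∀ (F : (Fin r → ℤ) → W),
      polyAct P (fun j => F (g j)) = fun j => polyAct (MvPolynomial.rename e P) F (g j) := by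
  induction P using MvPolynomial.induction_on with
  | C c => intro F; funext j; simp
  | add p q hp hq => intro F; funext j; simp [hp, hq]
  | mul_X p i hp =>
    intro F
    rw [map_mul (MvPolynomial.rename e), MvPolynomial.rename_X]
    simp only [polyAct_mul]
    rw [← hp]
    congr 1; funext j; simp [hg]

/-- Applying a linear map to the values of a family commutes with the action of polynomials. -/
lemma polyAct_map {r : ℕ} {W' : Type*} [AddCommGroup W'] [Module ℂ W'] (L : W →ₗ[ℂ] W')
    (P : MvPolynomial (Fin r) ℂ) (F : (Fin r → ℤ) → W) :
    polyAct P (fun k => L (F k)) = fun k => L (polyAct P F k) := by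
  induction P using MvPolynomial.induction_on generalizing F with
  | C c => funext j; simp
  | add p q hp hq => funext j; simp [hp, hq]
  | mul_X p i hp =>
    simp only [polyAct_mul]
    rw [← hp]
    congr 1; funext j; simp

/-! ### Substitution along a line -/

lemma binom_succ (m : ℤ) (j : ℕ) : binom (m + 1) (j + 1) = binom m (j + 1) + binom m j := by
  simp only [binom]
  rw [Finset.prod_range_succ', Finset.prod_range_succ, Nat.factorial_succ]
  have h : ∀ i : ℕ, ((m + 1 : ℤ) : ℂ) - ((i + 1 : ℕ) : ℂ) = (m : ℂ) - i := by
    intro i; push_cast; ring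
  simp only [h]
  have h1 : ((j : ℂ) + 1) ≠ 0 := by exact_mod_cast Nat.succ_ne_zero j
  have h2 : ((j.factorial : ℕ) : ℂ) ≠ 0 := by exact_mod_cast j.factorial_ne_zero
  push_cast
  field_simp
  ring

@[simp] lemma binom_zero (m : ℤ) : binom m 0 = 1 := by simp [binom]

/-- The direction of the lines along which substituting `x_b + x_c` for a variable sums. -/
abbrev lineVec {r : ℕ} (b c : Fin r) : Fin r → ℤ := unitVec c - unitVec b

/-- The substitution `y = x_b + x_c`, where the variable `y` sits at the position `c`, expanded in
nonnegative powers of `x_c`. -/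
def lineSubst {r : ℕ} (b c : Fin r) (F : (Fin r → ℤ) → W) : (Fin r → ℤ) → W := fun k =>
  if 0 ≤ k c then ∑ᶠ m : ℤ, binom m (k c).toNat • F (k + (m - k c) • lineVec b c) else 0

/-- The substitution `y ↦ x_b + x_c` on polynomials. -/
def subPoly {r : ℕ} (b c : Fin r) : MvPolynomial (Fin r) ℂ →ₐ[ℂ] MvPolynomial (Fin r) ℂ :=
  MvPolynomial.aeval (Function.update MvPolynomial.X c (MvPolynomial.X b + MvPolynomial.X c))

lemma subPoly_injective {r : ℕ} {b c : Fin r} (h : b ≠ c) :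
    Function.Injective (subPoly b c) := by
  obtain ⟨g, hg⟩ : ∃ g : MvPolynomial (Fin r) ℂ →ₐ[ℂ] MvPolynomial (Fin r) ℂ,
      g.comp (subPoly b c) = AlgHom.id ℂ _ := by
    refine ⟨MvPolynomial.aeval (Function.update MvPolynomial.X c
      (MvPolynomial.X c - MvPolynomial.X b)), ?_⟩
    ext1 i
    by_cases hi : i = c
    · subst hi; simp [subPoly, h]
    · simp [subPoly, hi]
  intro P Q e
  have hP : g (subPoly b c P) = P := DFunLike.congr_fun hg P
  have hQ : g (subPoly b c Q) = Q := DFunLike.congr_fun hg Q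
  rw [← hP, e, hQ]

/-- Families that are finite along the lines of direction `lineVec b c` through points of `U`. -/
def lineFinite {r : ℕ} (b c : Fin r) (U : Set (Fin r → ℤ)) (W : Type*) [AddCommGroup W]
    [Module ℂ W] : Submodule ℂ ((Fin r → ℤ) → W) where
  carrier := {F | ∀ k ∈ U, (fun m : ℤ => F (k + m • lineVec b c)).HasFiniteSupport}
  add_mem' hF hG k hk := (hF k hk).add (hG k hk)
  zero_mem' k _ := by simp [Function.HasFiniteSupport]
  smul_mem' a F hF k hk := (hF k hk).subset (Function.support_const_smul_subset a _)

lemma lineFinite_polyAct {r : ℕ} {b c : Fin r} {U : Set (Fin r → ℤ)}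
    (hU : ∀ k ∈ U, ∀ i, k - unitVec i ∈ U) (P : MvPolynomial (Fin r) ℂ)
    {F : (Fin r → ℤ) → W} (hF : F ∈ lineFinite b c U W) :
    polyAct P F ∈ lineFinite b c U W := by
  refine polyAct_mem _ (fun F hF i k hk => ?_) P F hF
  have := hF _ (hU k hk i)
  simpa [sub_add_eq_add_sub] using this

lemma lineFinite.subst {r : ℕ} {b c : Fin r} {U : Set (Fin r → ℤ)} {F : (Fin r → ℤ) → W}
    (hF : F ∈ lineFinite b c U W) {k : Fin r → ℤ} (hk : k ∈ U) (a : ℤ → ℂ) (n : ℤ) :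
    (fun m : ℤ => a m • F (k + (m - n) • lineVec b c)).HasFiniteSupport := by
  have h := (hF k hk).preimage (f := fun m : ℤ => m - n) (fun _ _ _ _ h => by simpa using h)
  exact h.subset fun m hm hm' => hm (smul_eq_zero_of_right _ hm')

lemma lineSubst_add {r : ℕ} {b c : Fin r} {U : Set (Fin r → ℤ)} {F G : (Fin r → ℤ) → W}
    (hF : F ∈ lineFinite b c U W) (hG : G ∈ lineFinite b c U W) :
    Set.EqOn (lineSubst b c (F + G)) (lineSubst b c F + lineSubst b c G) U := by
  intro k hk
  simp only [lineSubst, Pi.add_apply]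
  split_ifs
  · simp only [smul_add]
    exact finsum_add_distrib (lineFinite.subst hF hk _ _) (lineFinite.subst hG hk _ _)
  · simp

lemma lineSubst_smul {r : ℕ} (b c : Fin r) (a : ℂ) (F : (Fin r → ℤ) → W) :
    lineSubst b c (a • F) = a • lineSubst b c F := by
  funext k
  simp only [lineSubst, Pi.smul_apply, smul_finsum, smul_ite, smul_zero]
  simp only [smul_comm a]

lemma lineSubst_X {r : ℕ} {b c : Fin r} (hbc : b ≠ c) {U : Set (Fin r → ℤ)}
    (hU : ∀ k ∈ U, ∀ i, k - unitVec i ∈ U) {F : (Fin r → ℤ) → W}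
    (hF : F ∈ lineFinite b c U W) (i : Fin r) :
    Set.EqOn (lineSubst b c (polyAct (MvPolynomial.X i) F))
      (polyAct (subPoly b c (MvPolynomial.X i)) (lineSubst b c F)) U := by
  intro k hk
  by_cases hi : i = c
  · subst hi
    have hcb : (k - unitVec b) i = k i := by simp [hbc.symm]
    have hci : (k - unitVec i) i = k i - 1 := by simp
    simp only [subPoly, MvPolynomial.aeval_X, Function.update_self, polyAct_add, Pi.add_apply,
      polyAct_X]
    simp only [lineSubst, polyAct_X, hcb, hci]
    by_cases h0 : 0 ≤ k i
    · rw [if_pos h0, if_pos h0]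
      have e1 : ∀ m : ℤ, k + (m + 1 - k i) • lineVec b i - unitVec i =
          k - unitVec b + (m - k i) • lineVec b i := by
        intro m; simp only [lineVec]; module
      have e2 : ∀ m : ℤ, k - unitVec i + (m - (k i - 1)) • lineVec b i =
          k - unitVec b + (m - k i) • lineVec b i := by
        intro m; simp only [lineVec]; module
      rw [← finsum_comp_equiv (Equiv.addRight (1 : ℤ))]
      simp only [Equiv.coe_addRight, e1, e2]
      obtain ⟨n, hn⟩ := Int.eq_ofNat_of_zero_le h0
      cases n with
      | zero => simp [hn]
      | succ n =>
        have h1 : (k i).toNat = n + 1 := by omega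
        have h2 : (k i - 1).toNat = n := by omega
        rw [if_pos (by omega), h1, h2, ← finsum_add_distrib
          (lineFinite.subst hF (hU k hk b) _ _) (lineFinite.subst hF (hU k hk b) _ _)]
        simp only [binom_succ, add_smul]
    · rw [if_neg h0, if_neg h0, if_neg (by omega), add_zero]
  · have h : (k - unitVec i) c = k c := by simp [Ne.symm hi]
    simp only [subPoly, MvPolynomial.aeval_X, Function.update_of_ne hi, polyAct_X]
    simp only [lineSubst, polyAct_X, h, sub_add_eq_add_sub]

lemma lineSubst_polyAct {r : ℕ} {b c : Fin r} (hbc : b ≠ c) {U : Set (Fin r → ℤ)}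
    (hU : ∀ k ∈ U, ∀ i, k - unitVec i ∈ U) (P : MvPolynomial (Fin r) ℂ) :
    ∀ {F : (Fin r → ℤ) → W}, F ∈ lineFinite b c U W →
      Set.EqOn (lineSubst b c (polyAct P F)) (polyAct (subPoly b c P) (lineSubst b c F)) U := by
  induction P using MvPolynomial.induction_on with
  | C a =>
    intro F hF k _
    rw [polyAct_C, lineSubst_smul, ← MvPolynomial.algebraMap_eq, AlgHom.commutes,
      MvPolynomial.algebraMap_eq, polyAct_C]
  | add p q hp hq =>
    intro F hF k hk
    rw [polyAct_add, map_add, polyAct_add, Pi.add_apply, ← hp hF hk, ← hq hF hk]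
    exact lineSubst_add (lineFinite_polyAct hU p hF) (lineFinite_polyAct hU q hF) hk
  | mul_X p i hp =>
    intro F hF
    rw [polyAct_mul, map_mul, polyAct_mul]
    exact (hp (lineFinite_polyAct hU _ hF)).trans
      (polyAct_congr hU _ (lineSubst_X hbc hU hF i))

/-! ### Truncation conditions -/

/-- The space `W((x₁,…,x_r))` of families. -/
def laurentN (r : ℕ) (W : Type*) [AddCommGroup W] [Module ℂ W] :
    Submodule ℂ ((Fin r → ℤ) → W) where
  carrier := {F | IsLaurentN F}
  add_mem' := by
    rintro F G ⟨N, hN⟩ ⟨M, hM⟩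
    refine ⟨min N M, fun k ⟨i, hi⟩ => ?_⟩
    rw [Pi.add_apply, hN k ⟨i, by omega⟩, hM k ⟨i, by omega⟩, add_zero]
  zero_mem' := ⟨0, fun _ _ => rfl⟩
  smul_mem' := by
    rintro a F ⟨N, hN⟩
    exact ⟨N, fun k hk => by rw [Pi.smul_apply, hN k hk, smul_zero]⟩

lemma laurentN_polyAct {r : ℕ} (P : MvPolynomial (Fin r) ℂ) {F : (Fin r → ℤ) → W}
    (hF : F ∈ laurentN r W) : polyAct P F ∈ laurentN r W := by
  refine polyAct_mem _ (fun F hF i => ?_) P F hF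
  obtain ⟨N, hN⟩ := hF
  refine ⟨N, fun k ⟨j, hj⟩ => ?_⟩
  rw [polyAct_X]
  refine hN _ ⟨j, ?_⟩
  have : 0 ≤ unitVec i j := by
    by_cases h : j = i
    · subst h; simp
    · simp [h]
  simp only [Pi.sub_apply]
  omega

lemma isLaurent2_iff (F : (Fin 2 → ℤ) → W) :
    IsLaurent2 (fun m t => F ![m, t]) ↔ F ∈ laurentN 2 W := by
  refine exists_congr fun N => ⟨fun h k ⟨i, hi⟩ => ?_, fun h m t hmt => h _ ?_⟩
  · have hk : k = ![k 0, k 1] := by funext i; fin_cases i <;> rfl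
    rw [hk]
    refine h _ _ ?_
    fin_cases i
    · exact Or.inl hi
    · exact Or.inr hi
  · rcases hmt with h | h
    · exact ⟨0, h⟩
    · exact ⟨1, h⟩

/-- The space `W((x))((x₀))` of families in `x₀` (position `0`) and `x` (position `1`). -/
def iterLaurent (W : Type*) [AddCommGroup W] [Module ℂ W] :
    Submodule ℂ ((Fin 2 → ℤ) → W) where
  carrier := {F | (∃ N : ℤ, ∀ k, k 0 < N → F k = 0) ∧
    ∀ J : ℤ, ∃ N : ℤ, ∀ k, k 0 = J → k 1 < N → F k = 0}
  add_mem' := by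
    rintro F G ⟨⟨N, hN⟩, hF⟩ ⟨⟨M, hM⟩, hG⟩
    refine ⟨⟨min N M, fun k hk => ?_⟩, fun J => ?_⟩
    · rw [Pi.add_apply, hN k (by omega), hM k (by omega), add_zero]
    · obtain ⟨N, hN⟩ := hF J
      obtain ⟨M, hM⟩ := hG J
      refine ⟨min N M, fun k hJ hk => ?_⟩
      rw [Pi.add_apply, hN k hJ (by omega), hM k hJ (by omega), add_zero]
  zero_mem' := ⟨⟨0, fun _ _ => rfl⟩, fun _ => ⟨0, fun _ _ _ => rfl⟩⟩
  smul_mem' := by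
    rintro a F ⟨⟨N, hN⟩, hF⟩
    refine ⟨⟨N, fun k hk => by rw [Pi.smul_apply, hN k hk, smul_zero]⟩, fun J => ?_⟩
    obtain ⟨M, hM⟩ := hF J
    exact ⟨M, fun k hJ hk => by rw [Pi.smul_apply, hM k hJ hk, smul_zero]⟩

lemma iterLaurent_shift {F : (Fin 2 → ℤ) → W} (hF : F ∈ iterLaurent W) (u : Fin 2 → ℤ) :
    (fun k => F (k - u)) ∈ iterLaurent W := by
  obtain ⟨⟨N, hN⟩, h⟩ := hF
  refine ⟨⟨N + u 0, fun k hk => hN _ (by simp only [Pi.sub_apply]; omega)⟩, fun J => ?_⟩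
  obtain ⟨M, hM⟩ := h (J - u 0)
  exact ⟨M + u 1, fun k hJ hk =>
    hM _ (by simp only [Pi.sub_apply]; omega) (by simp only [Pi.sub_apply]; omega)⟩

lemma iterLaurent_polyAct (P : MvPolynomial (Fin 2) ℂ) {F : (Fin 2 → ℤ) → W}
    (hF : F ∈ iterLaurent W) : polyAct P F ∈ iterLaurent W := by
  refine polyAct_mem _ (fun F hF i => ?_) P F hF
  rw [show polyAct (MvPolynomial.X i) F = fun k => F (k - unitVec i) from
    funext fun k => polyAct_X i F k]
  exact iterLaurent_shift hF _

lemma laurentN_lineFinite {r : ℕ} {b c : Fin r} (hbc : b ≠ c) {F : (Fin r → ℤ) → W}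
    (hF : F ∈ laurentN r W) : F ∈ lineFinite b c Set.univ W := by
  obtain ⟨N, hN⟩ := hF
  intro k _
  refine (Set.finite_Icc (N - k c) (k b - N)).subset fun m hm => ?_
  by_contra hm'
  refine hm (hN _ ?_)
  rw [Set.mem_Icc, not_and_or] at hm'
  rcases hm' with h | h
  · exact ⟨c, by simp [hbc.symm]; omega⟩
  · exact ⟨b, by simp [hbc]; omega⟩

lemma lineSubst_eq_zero_of_neg {r : ℕ} {b c : Fin r} {F : (Fin r → ℤ) → W} {k : Fin r → ℤ}
    (hk : k c < 0) : lineSubst b c F k = 0 := if_neg (by omega)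

lemma lineSubst_mem_iterLaurent {F : (Fin 2 → ℤ) → W} (hF : F ∈ laurentN 2 W) :
    lineSubst 1 0 F ∈ iterLaurent W := by
  obtain ⟨N, hN⟩ := hF
  refine ⟨⟨0, fun k => lineSubst_eq_zero_of_neg⟩, fun J => ⟨2 * N - J, fun k hJ hk => ?_⟩⟩
  simp only [lineSubst]
  split_ifs with h0
  · refine finsum_eq_zero_of_forall_eq_zero fun m => ?_
    rw [hN, smul_zero]
    by_cases hm : m < N
    · exact ⟨0, by simpa using hm⟩
    · exact ⟨1, by simp; omega⟩
  · rfl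

/-! ### Convolution -/

/-- The product of a scalar-valued and a vector-valued family. -/
def conv {r : ℕ} (c : (Fin r → ℤ) → ℂ) (F : (Fin r → ℤ) → W) : (Fin r → ℤ) → W := fun k =>
  ∑ᶠ s : Fin r → ℤ, c s • F (k - s)

lemma conv_finite {c : (Fin 2 → ℤ) → ℂ} {F : (Fin 2 → ℤ) → W} (hc : c ∈ iterLaurent ℂ)
    (hF : F ∈ iterLaurent W) (k : Fin 2 → ℤ) :
    (fun s : Fin 2 → ℤ => c s • F (k - s)).HasFiniteSupport := by
  obtain ⟨⟨N, hN⟩, hc⟩ := hc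
  obtain ⟨⟨M, hM⟩, hF⟩ := hF
  choose a ha using hc
  choose b hb using hF
  refine ((Set.finite_Icc N (k 0 - M)).biUnion fun s _ =>
    (Set.finite_Icc (a s) (k 1 - b (k 0 - s))).image fun t => ![s, t]).subset fun s hs => ?_
  have h1 : c s ≠ 0 := fun h => hs (by simp [h])
  have h2 : F (k - s) ≠ 0 := fun h => hs (by simp [h])
  simp only [Set.mem_iUnion]
  refine ⟨s 0, ⟨?_, ?_⟩, s 1, ⟨?_, ?_⟩, ?_⟩
  · by_contra h; exact h1 (hN _ (by omega))
  · by_contra h; exact h2 (hM _ (by simp only [Pi.sub_apply]; omega))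
  · by_contra h; exact h1 (ha _ _ rfl (by omega))
  · by_contra h; exact h2 (hb (k 0 - s 0) (k - s) rfl (by simp only [Pi.sub_apply]; omega))
  · funext i; fin_cases i <;> rfl

lemma conv_add_left {c d : (Fin 2 → ℤ) → ℂ} {F : (Fin 2 → ℤ) → W} (hc : c ∈ iterLaurent ℂ)
    (hd : d ∈ iterLaurent ℂ) (hF : F ∈ iterLaurent W) :
    conv (c + d) F = conv c F + conv d F := by
  funext k
  simp only [conv, Pi.add_apply, add_smul]
  exact finsum_add_distrib (conv_finite hc hF k) (conv_finite hd hF k)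

lemma conv_add_right {c : (Fin 2 → ℤ) → ℂ} {F G : (Fin 2 → ℤ) → W} (hc : c ∈ iterLaurent ℂ)
    (hF : F ∈ iterLaurent W) (hG : G ∈ iterLaurent W) :
    conv c (F + G) = conv c F + conv c G := by
  funext k
  simp only [conv, Pi.add_apply, smul_add]
  exact finsum_add_distrib (conv_finite hc hF k) (conv_finite hc hG k)

lemma conv_smul_right {r : ℕ} (a : ℂ) (c : (Fin r → ℤ) → ℂ) (F : (Fin r → ℤ) → W) :
    conv c (a • F) = a • conv c F := by
  funext k
  simp only [conv, Pi.smul_apply, smul_finsum]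
  simp only [smul_comm a]

lemma conv_polyAct_left (P : MvPolynomial (Fin 2) ℂ) :
    ∀ {c : (Fin 2 → ℤ) → ℂ} {F : (Fin 2 → ℤ) → W}, c ∈ iterLaurent ℂ → F ∈ iterLaurent W →
      conv (polyAct P c) F = polyAct P (conv c F) := by
  induction P using MvPolynomial.induction_on with
  | C a =>
    intro c F _ _
    funext k
    simp only [polyAct_C, conv, Pi.smul_apply, smul_finsum, smul_assoc]
  | add p q hp hq =>
    intro c F hc hF
    rw [polyAct_add, polyAct_add,
      conv_add_left (iterLaurent_polyAct p hc) (iterLaurent_polyAct q hc) hF, hp hc hF, hq hc hF]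
  | mul_X p i hp =>
    intro c F hc hF
    rw [polyAct_mul, polyAct_mul, hp (iterLaurent_polyAct _ hc) hF]
    congr 1
    funext k
    simp only [conv, polyAct_X]
    rw [← finsum_comp_equiv (Equiv.addRight (unitVec i))]
    simp [sub_sub, add_comm]

lemma conv_polyAct_right (P : MvPolynomial (Fin 2) ℂ) :
    ∀ {c : (Fin 2 → ℤ) → ℂ} {F : (Fin 2 → ℤ) → W}, c ∈ iterLaurent ℂ → F ∈ iterLaurent W →
      conv c (polyAct P F) = polyAct P (conv c F) := by
  induction P using MvPolynomial.induction_on with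
  | C a => intro c F _ _; rw [polyAct_C, polyAct_C, conv_smul_right]
  | add p q hp hq =>
    intro c F hc hF
    rw [polyAct_add, polyAct_add,
      conv_add_right hc (iterLaurent_polyAct p hF) (iterLaurent_polyAct q hF), hp hc hF, hq hc hF]
  | mul_X p i hp =>
    intro c F hc hF
    rw [polyAct_mul, polyAct_mul, hp hc (iterLaurent_polyAct _ hF)]
    congr 1
    funext k
    simp only [conv, polyAct_X, sub_right_comm]

lemma conv_mem_iterLaurent {c : (Fin 2 → ℤ) → ℂ} {F : (Fin 2 → ℤ) → W}
    (hc : c ∈ iterLaurent ℂ) (hF : F ∈ iterLaurent W) : conv c F ∈ iterLaurent W := by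
  obtain ⟨⟨N, hN⟩, hc⟩ := hc
  obtain ⟨⟨M, hM⟩, hF⟩ := hF
  refine ⟨⟨N + M, fun k hk => finsum_eq_zero_of_forall_eq_zero fun s => ?_⟩, fun J => ?_⟩
  · by_cases hs : s 0 < N
    · rw [hN s hs, zero_smul]
    · rw [hM _ (by simp only [Pi.sub_apply]; omega), smul_zero]
  · choose a ha using hc
    choose b hb using hF
    obtain ⟨L, hL⟩ := ((Set.finite_Icc N (J - M)).image fun s => a s + b (J - s)).bddBelow
    refine ⟨L, fun k hJ hk => finsum_eq_zero_of_forall_eq_zero fun s => ?_⟩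
    by_cases h1 : s 0 < N
    · rw [hN s h1, zero_smul]
    by_cases h2 : J - M < s 0
    · rw [hM _ (by simp only [Pi.sub_apply]; omega), smul_zero]
    have h3 := hL ⟨s 0, ⟨by omega, by omega⟩, rfl⟩
    by_cases h4 : s 1 < a (s 0)
    · rw [ha _ s rfl h4, zero_smul]
    · rw [hb (J - s 0) _ (by simp only [Pi.sub_apply]; omega)
        (by simp only [Pi.sub_apply]; dsimp only at h3; omega), smul_zero]

/-- The unit for convolution. -/
abbrev deltaFam (r : ℕ) : (Fin r → ℤ) → ℂ := Pi.single 0 1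

lemma conv_delta {r : ℕ} (F : (Fin r → ℤ) → W) : conv (deltaFam r) F = F := by
  funext k
  rw [conv, finsum_eq_single _ 0 (fun s hs => by simp [hs])]
  simp

/-! ### Coefficients of elements of `ℂ((x))((x₀))` -/

/-- The family of coefficients of an element of `ℂ((x))((x₀))`. -/
def coeffK (g : K2) : (Fin 2 → ℤ) → ℂ := fun k => (g.coeff (k 0)).coeff (k 1)

lemma coeffK_mem (g : K2) : coeffK g ∈ iterLaurent ℂ := by
  refine ⟨⟨g.order, fun k hk => ?_⟩, fun J => ⟨(g.coeff J).order, fun k hJ hk => ?_⟩⟩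
  · simp [coeffK, HahnSeries.coeff_eq_zero_of_lt_order hk]
  · subst hJ
    exact HahnSeries.coeff_eq_zero_of_lt_order hk

lemma coeffK_one : coeffK 1 = deltaFam 2 := by
  funext k
  by_cases h0 : k 0 = 0
  · by_cases h1 : k 1 = 0
    · have : k = 0 := by funext i; fin_cases i <;> assumption
      subst this; simp [coeffK]
    · have : k ≠ 0 := fun h => h1 (by simp [h])
      simp [coeffK, h0, HahnSeries.coeff_one, h1, this]
  · have : k ≠ 0 := fun h => h0 (by simp [h])
    simp [coeffK, HahnSeries.coeff_one, h0, this]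

section FieldK

/-- The field structure of `ℂ((x))((x₀))`. -/
@[reducible] def fieldK : Field K2 := inferInstance

attribute [local instance] fieldK

/-- A polynomial in the outer and the inner variable as an element of `ℂ((x))((x₀))`. -/
def polyK : MvPolynomial (Fin 2) ℂ →ₐ[ℂ] K2 := MvPolynomial.aeval ![xOuter, xInner]

lemma algebraMap_K (a : ℂ) :
    algebraMap ℂ K2 a = HahnSeries.single 0 (HahnSeries.single 0 a) := by
  rw [HahnSeries.algebraMap_apply', PowerSeries.algebraMap_apply, HahnSeries.ofPowerSeries_C,
    HahnSeries.algebraMap_apply', PowerSeries.algebraMap_apply, HahnSeries.ofPowerSeries_C]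
  rfl

lemma coeffK_polyK_mul (P : MvPolynomial (Fin 2) ℂ) :
    ∀ g : K2, coeffK (polyK P * g) = polyAct P (coeffK g) := by
  induction P using MvPolynomial.induction_on with
  | C a =>
    intro g
    rw [polyAct_C, ← MvPolynomial.algebraMap_eq, AlgHom.commutes, algebraMap_K]
    funext k
    simp [coeffK]
  | add p q hp hq =>
    intro g
    rw [map_add, add_mul, polyAct_add, ← hp, ← hq]
    rfl
  | mul_X p i hp =>
    intro g
    rw [map_mul, mul_assoc, hp, polyAct_mul]
    congr 1
    funext k
    rw [polyAct_X]
    fin_cases i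
    · simp [polyK, coeffK, xOuter, HahnSeries.coeff_single_mul]
    · simp [polyK, coeffK, xInner, HahnSeries.coeff_single_mul]

lemma polyK_ne_zero {P : MvPolynomial (Fin 2) ℂ} (hP : P ≠ 0) : polyK P ≠ 0 := by
  intro h
  obtain ⟨d, hd⟩ := MvPolynomial.ne_zero_iff.1 hP
  have h1 := congrFun (coeffK_polyK_mul P 1) fun i => d i
  rw [h, zero_mul, coeffK_one, ← mulPolyN_eq, mulPolyN, Finset.sum_eq_single d] at h1
  · exact hd (by simpa [coeffK, Pi.single_apply, funext_iff] using h1.symm)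
  · intro e _ he
    have : (fun i => (d i : ℤ) - e i) ≠ 0 := by
      intro h
      refine he (Finsupp.ext fun i => ?_)
      have := congrFun h i
      simp only [Pi.zero_apply] at this
      omega
    simp [this]
  · intro h; simp [MvPolynomial.notMem_support_iff.1 h]

lemma conv_inv_polyAct {P : MvPolynomial (Fin 2) ℂ} (hP : P ≠ 0) {F : (Fin 2 → ℤ) → W}
    (hF : F ∈ iterLaurent W) : polyAct P (conv (coeffK (polyK P)⁻¹) F) = F := by
  rw [← conv_polyAct_left P (coeffK_mem _) hF, ← coeffK_polyK_mul,
    mul_inv_cancel₀ (polyK_ne_zero hP), coeffK_one, conv_delta]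

/-- Nonzero polynomials act injectively on `W((x))((x₀))`. -/
lemma polyAct_injOn_iterLaurent {P : MvPolynomial (Fin 2) ℂ} (hP : P ≠ 0) :
    Set.InjOn (polyAct (W := W) P) (iterLaurent W) := by
  intro F hF G hG h
  rw [← conv_inv_polyAct hP hF, ← conv_inv_polyAct hP hG,
    ← conv_polyAct_right P (coeffK_mem _) hF, ← conv_polyAct_right P (coeffK_mem _) hG, h]

lemma qK_eq (p : MvPolynomial (Fin 2) ℂ) : qK p 1 = polyK (subPoly 1 0 p) := by
  have : (MvPolynomial.aeval ![xOuter + xInnerC 1, xInner] : MvPolynomial (Fin 2) ℂ →ₐ[ℂ] K2) =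
      polyK.comp (subPoly 1 0) := by
    ext1 i
    fin_cases i
    · simp [polyK, subPoly, xInnerC, xInner, add_comm]
    · simp [polyK, subPoly]
  exact DFunLike.congr_fun this p

end FieldK

/-! ### Products of two fields -/

@[simp] lemma mf_add_vec (a : EW W) (w w' : W) (n : ℤ) :
    mf a (w + w') n = mf a w n + mf a w' n := by
  simp [mf]

@[simp] lemma mf_smul_vec (a : EW W) (c : ℂ) (w : W) (n : ℤ) : mf a (c • w) n = c • mf a w n := by
  simp [mf]

lemma mf_ext {a b : EW W} (h : ∀ w n, mf a w n = mf b w n) : a = b :=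
  Subtype.ext (LinearMap.ext fun w => funext fun n => h w n)

/-- The mode `a_n` as a linear map. -/
def modeMap (a : EW W) (n : ℤ) : W →ₗ[ℂ] W where
  toFun w := mf a w n
  map_add' w w' := mf_add_vec a w w' n
  map_smul' c w := mf_smul_vec a c w n

/-- The family of coefficients of `a(x₁) b(x₂) w`. -/
def famAB (a b : EW W) (w : W) : (Fin 2 → ℤ) → W := fun k => Fab a b w (k 0) (k 1)

/-- The family of coefficients of `Y_ℰ(a(x), x₀) b(x) w`, with `x₀` at the position `0`. -/
def famYE (a b : EW W) (w : W) : (Fin 2 → ℤ) → W :=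
  fun k => mf (YE a b (-(k 0) - 1)) w (-(k 1) - 1)

lemma famAB_add (a b : EW W) (w w' : W) : famAB a b (w + w') = famAB a b w + famAB a b w' := by
  funext k; simp [famAB, Fab]

lemma famAB_smul (a b : EW W) (c : ℂ) (w : W) : famAB a b (c • w) = c • famAB a b w := by
  funext k; simp [famAB, Fab]

lemma isLaurent2_mulPoly (p : MvPolynomial (Fin 2) ℂ) (a b : EW W) (w : W) :
    IsLaurent2 (mulPoly p (Fab a b w)) ↔ polyAct p (famAB a b w) ∈ laurentN 2 W := by
  rw [← isLaurent2_iff]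
  simp only [← mulPoly_eq]
  rfl

lemma vec2_eta (k : Fin 2 → ℤ) : ![k 0, k 1] = k := by
  funext i; fin_cases i <;> rfl

lemma substYE_eq (p : MvPolynomial (Fin 2) ℂ) (a b : EW W) (w : W) (j : ℕ) (t : ℤ) :
    substYE 1 p a b w j t = lineSubst 1 0 (polyAct p (famAB a b w)) ![(j : ℤ), t] := by
  rw [lineSubst, if_pos (by simp), substYE]
  refine finsum_congr fun m => ?_
  have h := mulPoly_eq p (famAB a b w) m (t - m + j)
  rw [one_zpow, mul_one]
  refine congrArg₂ (· • ·) (by simp) (h.trans (congrArg _ ?_))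
  funext i
  fin_cases i
  · simp
  · simp; ring

lemma fullYE_eq (p : MvPolynomial (Fin 2) ℂ) (a b : EW W) (w : W) (k : Fin 2 → ℤ) :
    fullYE 1 p a b w (k 0) (k 1) =
      conv (coeffK (polyK (subPoly 1 0 p))⁻¹) (lineSubst 1 0 (polyAct p (famAB a b w))) k := by
  rw [fullYE, conv, ← finsum_comp_equiv (finTwoArrowEquiv ℤ)]
  refine finsum_congr fun s => congrArg₂ (· • ·) ?_ ?_
  · rw [← qK_eq]; rfl
  · simp only [finTwoArrowEquiv_apply]
    split_ifs with h
    · rw [substYE_eq, Int.toNat_of_nonneg h, ← vec2_eta (k - s)]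
      rfl
    · rw [lineSubst_eq_zero_of_neg]
      simpa using h

lemma exists_modes {a b : EW W} (h : QCPair a b) (n : ℤ) :
    ∃ c : EW W, ∀ w m, mf c w m = rawYE 1 a b n w m := by
  have hL := fun w => (isLaurent2_mulPoly _ a b w).1 (h.choose_spec.2 w)
  set p := h.choose
  have hI := fun w => lineSubst_mem_iterLaurent (hL w)
  have hr : ∀ w m, rawYE 1 a b n w m = conv (coeffK (polyK (subPoly 1 0 p))⁻¹)
      (lineSubst 1 0 (polyAct p (famAB a b w))) ![-n - 1, -m - 1] := fun w m => by
    rw [← fullYE_eq, rawYE, dif_pos h]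
    rfl
  refine ⟨⟨{ toFun := fun w m => rawYE 1 a b n w m, map_add' := ?_, map_smul' := ?_ }, ?_⟩,
    fun w m => rfl⟩
  · intro w w'
    funext m
    have e : lineSubst 1 0 (polyAct p (famAB a b (w + w'))) =
        lineSubst 1 0 (polyAct p (famAB a b w)) + lineSubst 1 0 (polyAct p (famAB a b w')) := by
      rw [famAB_add, map_add]
      exact funext fun k => lineSubst_add (laurentN_lineFinite (by decide) (hL w))
        (laurentN_lineFinite (by decide) (hL w')) (Set.mem_univ k)
    rw [Pi.add_apply, hr, hr, hr, e, conv_add_right (coeffK_mem _) (hI w) (hI w'), Pi.add_apply]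
  · intro c w
    funext m
    rw [RingHom.id_apply, Pi.smul_apply, hr, hr, famAB_smul, map_smul, lineSubst_smul,
      conv_smul_right, Pi.smul_apply]
  · intro w
    obtain ⟨N, hN⟩ :=
      (conv_mem_iterLaurent (coeffK_mem (polyK (subPoly 1 0 p))⁻¹) (hI w)).2 (-n - 1)
    refine ⟨-N, fun m hm => ?_⟩
    exact (hr w m).trans (hN _ rfl (show -m - 1 < N by omega))

lemma famYE_eq {a b : EW W} (h : QCPair a b) (w : W) :
    famYE a b w = conv (coeffK (polyK (subPoly 1 0 h.choose))⁻¹)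
      (lineSubst 1 0 (polyAct h.choose (famAB a b w))) := by
  funext k
  have e : ∀ n, ∃ c : EW W, ∀ w m, mf c w m = rawYE ((1 : ℂˣ) : ℂ) a b n w m := by
    simpa using exists_modes h
  rw [← fullYE_eq, famYE, YE, YEa, dif_pos (e _), (e _).choose_spec, Units.val_one, rawYE,
    dif_pos h]
  congr 1 <;> ring

lemma famYE_mem_iterLaurent {a b : EW W} (h : QCPair a b) (w : W) :
    famYE a b w ∈ iterLaurent W := by
  rw [famYE_eq h]
  exact conv_mem_iterLaurent (coeffK_mem _)
    (lineSubst_mem_iterLaurent ((isLaurent2_mulPoly _ a b w).1 (h.choose_spec.2 w)))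

lemma subPoly_ne_zero {r : ℕ} {b c : Fin r} (h : b ≠ c) {P : MvPolynomial (Fin r) ℂ}
    (hP : P ≠ 0) : subPoly b c P ≠ 0 :=
  (map_ne_zero_iff _ (subPoly_injective h)).2 hP

/-- The defining property of `Y_ℰ`, for an arbitrary polynomial `p`. -/
lemma polyAct_famYE {a b : EW W} (h : QCPair a b) {p : MvPolynomial (Fin 2) ℂ} {w : W}
    (hp : polyAct p (famAB a b w) ∈ laurentN 2 W) :
    polyAct (subPoly 1 0 p) (famYE a b w) = lineSubst 1 0 (polyAct p (famAB a b w)) := by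
  have h10 : (1 : Fin 2) ≠ 0 := by decide
  have hq : polyAct h.choose (famAB a b w) ∈ laurentN 2 W :=
    (isLaurent2_mulPoly _ a b w).1 (h.choose_spec.2 w)
  have hq0 := subPoly_ne_zero h10 h.choose_spec.1
  have e : polyAct (subPoly 1 0 h.choose) (famYE a b w) =
      lineSubst 1 0 (polyAct h.choose (famAB a b w)) := by
    rw [famYE_eq h, conv_inv_polyAct hq0 (lineSubst_mem_iterLaurent hq)]
  have hs : ∀ P {F : (Fin 2 → ℤ) → W}, F ∈ laurentN 2 W →
      lineSubst 1 0 (polyAct P F) = polyAct (subPoly 1 0 P) (lineSubst 1 0 F) := fun P F hF =>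
    funext fun k => lineSubst_polyAct h10 (fun _ _ _ => Set.mem_univ _) P
      (laurentN_lineFinite h10 hF) (Set.mem_univ k)
  refine polyAct_injOn_iterLaurent hq0 (iterLaurent_polyAct _ (famYE_mem_iterLaurent h w))
    (lineSubst_mem_iterLaurent hp) ?_
  rw [polyAct_comm, e, ← hs _ hq, ← hs _ hp, polyAct_comm]

lemma exists_YE_eq_zero {a b : EW W} (h : QCPair a b) :
    ∃ N : ℤ, ∀ J < N, YE a b (-J - 1) = 0 := by
  obtain ⟨N, hN⟩ := (coeffK_mem (polyK (subPoly 1 0 h.choose))⁻¹).1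
  refine ⟨N, fun J hJ => mf_ext fun w n => ?_⟩
  have e := congrFun (famYE_eq h w) ![J, -n - 1]
  have e' : mf (YE a b (-J - 1)) w n = famYE a b w ![J, -n - 1] := by
    simp [famYE]
  rw [e', e]
  refine finsum_eq_zero_of_forall_eq_zero fun s => ?_
  by_cases hs : s 0 < N
  · rw [hN s hs, zero_smul]
  · rw [lineSubst_eq_zero_of_neg, smul_zero]
    simp; omega

lemma QCSeq.qcPair {a b : EW W} (h : QCSeq ![a, b]) : QCPair a b := by
  obtain ⟨p, hp, hL⟩ := h
  refine ⟨p, hp, fun w => (isLaurent2_mulPoly p a b w).2 ?_⟩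
  have e1 : pairPoly p 2 = p := by
    have : Finset.univ.filter (fun ij : Fin 2 × Fin 2 => ij.1 < ij.2) = {(0, 1)} := by decide
    rw [pairPoly, this, Finset.prod_singleton]
    have : (![0, 1] : Fin 2 → Fin 2) = id := by funext i; fin_cases i <;> rfl
    simp [this]
  have := hL w
  rw [e1, mulPolyN_eq] at this
  exact this

/-! ### Two-variable slices -/

/-- The exponent with components `j` at the positions `e` and `y` elsewhere. -/
def insertAt {r : ℕ} (e : Fin 2 → Fin r) (y : ℤ) (j : Fin 2 → ℤ) : Fin r → ℤ := fun i =>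
  if i = e 0 then j 0 else if i = e 1 then j 1 else y

lemma insertAt_apply {r : ℕ} {e : Fin 2 → Fin r} (he : Function.Injective e) (y : ℤ)
    (j : Fin 2 → ℤ) (i : Fin 2) : insertAt e y j (e i) = j i := by
  have h : e 1 ≠ e 0 := fun h => absurd (he h) (by decide)
  fin_cases i <;> simp [insertAt, h]

lemma insertAt_add {r : ℕ} {e : Fin 2 → Fin r} (he : Function.Injective e) (y : ℤ)
    (j : Fin 2 → ℤ) (a : ℤ) (i : Fin 2) :
    insertAt e y (j + a • unitVec i) = insertAt e y j + a • unitVec (e i) := by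
  have h : e 0 ≠ e 1 := fun h => absurd (he h) (by decide)
  funext l
  by_cases h0 : l = e 0
  · subst h0; fin_cases i <;> simp [insertAt, h]
  by_cases h1 : l = e 1
  · subst h1; fin_cases i <;> simp [insertAt, h.symm]
  · fin_cases i <;> simp [insertAt, h0, h1]

lemma insertAt_sub {r : ℕ} {e : Fin 2 → Fin r} (he : Function.Injective e) (y : ℤ)
    (j : Fin 2 → ℤ) (i : Fin 2) :
    insertAt e y (j - unitVec i) = insertAt e y j - unitVec (e i) := by
  simpa [← sub_eq_add_neg] using insertAt_add he y j (-1) i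

lemma insertAt_line {r : ℕ} {e : Fin 2 → Fin r} (he : Function.Injective e) (y : ℤ)
    (j : Fin 2 → ℤ) (a : ℤ) :
    insertAt e y (j + a • lineVec 1 0) = insertAt e y j + a • lineVec (e 1) (e 0) := by
  have h : j + a • lineVec 1 0 = j + a • unitVec 0 + (-a) • unitVec 1 := by
    simp only [lineVec]; module
  rw [h, insertAt_add he, insertAt_add he]
  simp only [lineVec]; module

lemma insertAt_eta {r : ℕ} {e : Fin 2 → Fin r} {o : Fin r}
    (ho : ∀ i, i = e 0 ∨ i = e 1 ∨ i = o) (k : Fin r → ℤ) :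
    insertAt e (k o) (fun i => k (e i)) = k := by
  funext i
  simp only [insertAt]
  split_ifs with h0 h1
  · rw [h0]
  · rw [h1]
  · rw [((ho i).resolve_left h0).resolve_left h1]

/-- The two-variable family obtained by fixing the exponents off the positions `e`. -/
def slice {r : ℕ} (e : Fin 2 → Fin r) (y : ℤ) (F : (Fin r → ℤ) → W) : (Fin 2 → ℤ) → W :=
  fun j => F (insertAt e y j)

lemma slice_polyAct {r : ℕ} {e : Fin 2 → Fin r} (he : Function.Injective e) (y : ℤ)
    (p : MvPolynomial (Fin 2) ℂ) (F : (Fin r → ℤ) → W) :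
    slice e y (polyAct (MvPolynomial.rename e p) F) = polyAct p (slice e y F) :=
  (polyAct_comp e (insertAt e y) (insertAt_sub he y) p F).symm

lemma slice_lineSubst {r : ℕ} {e : Fin 2 → Fin r} (he : Function.Injective e) (y : ℤ)
    (F : (Fin r → ℤ) → W) :
    slice e y (lineSubst (e 1) (e 0) F) = lineSubst 1 0 (slice e y F) := by
  funext j
  simp only [slice, lineSubst, insertAt_apply he, insertAt_line he]

lemma subPoly_rename {r s : ℕ} {e : Fin s → Fin r} (he : Function.Injective e) (b c : Fin s)
    (p : MvPolynomial (Fin s) ℂ) :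
    subPoly (e b) (e c) (MvPolynomial.rename e p) = MvPolynomial.rename e (subPoly b c p) := by
  have : (subPoly (e b) (e c)).comp (MvPolynomial.rename e) =
      (MvPolynomial.rename e).comp (subPoly b c) := by
    ext1 i
    by_cases hi : i = c
    · subst hi; simp [subPoly]
    · simp [subPoly, hi, he.ne hi]
  exact DFunLike.congr_fun this p

lemma lineFinite_of_slice {r : ℕ} {e : Fin 2 → Fin r} (he : Function.Injective e) {o : Fin r}
    (ho : ∀ i, i = e 0 ∨ i = e 1 ∨ i = o) {U : Set (Fin r → ℤ)} {F : (Fin r → ℤ) → W}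
    (hF : ∀ k ∈ U, slice e (k o) F ∈ lineFinite 1 0 Set.univ W) :
    F ∈ lineFinite (e 1) (e 0) U W := by
  intro k hk
  have := hF k hk (fun i => k (e i)) (Set.mem_univ _)
  simpa only [slice, insertAt_line he, insertAt_eta ho] using this

lemma eqOn_of_slice {X : Type*} {r : ℕ} {e : Fin 2 → Fin r} {o : Fin r}
    (ho : ∀ i, i = e 0 ∨ i = e 1 ∨ i = o) {U : Set (Fin r → ℤ)} {F G : (Fin r → ℤ) → X}
    (h : ∀ k ∈ U, slice e (k o) F = slice e (k o) G) : Set.EqOn F G U := by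
  intro k hk
  have := congrFun (h k hk) (fun i => k (e i))
  simpa only [slice, insertAt_eta ho] using this

lemma slice_polyAct_mem_iterLaurent {r : ℕ} {e : Fin 2 → Fin r} (he : Function.Injective e)
    {o : Fin r} (ho : ∀ i, i = e 0 ∨ i = e 1 ∨ i = o) (hoe : ∀ i, o ≠ e i)
    (P : MvPolynomial (Fin r) ℂ) {F : (Fin r → ℤ) → W} (hF : ∀ y, slice e y F ∈ iterLaurent W)
    (y : ℤ) : slice e y (polyAct P F) ∈ iterLaurent W := by
  let D : Submodule ℂ ((Fin r → ℤ) → W) :=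
    { carrier := {F | ∀ y, slice e y F ∈ iterLaurent W}
      add_mem' := fun hF hG y => (iterLaurent W).add_mem (hF y) (hG y)
      zero_mem' := fun y => (iterLaurent W).zero_mem
      smul_mem' := fun a F hF y => (iterLaurent W).smul_mem a (hF y) }
  have hi : ∀ F ∈ D, ∀ (i : Fin 2) (y : ℤ),
      slice e y (polyAct (MvPolynomial.X (e i)) F) ∈ iterLaurent W := fun F hF i y => by
    rw [← MvPolynomial.rename_X, slice_polyAct he]
    exact iterLaurent_polyAct _ (hF y)
  refine polyAct_mem D (fun F hF i y => ?_) P F hF y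
  rcases ho i with rfl | rfl | rfl
  · exact hi F hF 0 y
  · exact hi F hF 1 y
  · have : slice e y (polyAct (MvPolynomial.X i) F) = slice e (y - 1) F := by
      funext j
      simp only [slice, polyAct_X]
      congr 1
      funext l
      rcases ho l with rfl | rfl | rfl
      · simp [insertAt_apply he, (hoe 0).symm]
      · simp [insertAt_apply he, (hoe 1).symm]
      · simp [insertAt, hoe]
    rw [this]
    exact hF _

/-! ### Iterated products of three fields -/

/-- The family of coefficients of `ψ(y) φ(z) θ(x) w`, in the variables `(x, y, z)`. -/
def famABC (ψ φ θ : EW W) (w : W) : (Fin 3 → ℤ) → W := fun k =>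
  mf ψ (famAB φ θ w ![k 2, k 0]) (-(k 1) - 1)

/-- The family of coefficients of `ψ(y) Y_ℰ(φ(x), x₂) θ(x) w`, in the variables `(x, y, x₂)`. -/
def famAYE (ψ φ θ : EW W) (w : W) : (Fin 3 → ℤ) → W := fun k =>
  mf ψ (famYE φ θ w ![k 2, k 0]) (-(k 1) - 1)

/-- The family of coefficients of `Y_ℰ(ψ(x), x₁) Y_ℰ(φ(x), x₂) θ(x) w`, in the variables
`(x, x₁, x₂)`. -/
def famYEYE (ψ φ θ : EW W) (w : W) : (Fin 3 → ℤ) → W := fun k =>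
  famYE ψ (YE φ θ (-(k 2) - 1)) w ![k 1, k 0]

lemma injective_vec20 : Function.Injective (![2, 0] : Fin 2 → Fin 3) := by decide

lemma injective_vec10 : Function.Injective (![1, 0] : Fin 2 → Fin 3) := by decide

lemma cover_vec20 : ∀ i, i = (![2, 0] : Fin 2 → Fin 3) 0 ∨ i = (![2, 0] : Fin 2 → Fin 3) 1 ∨
    i = 1 := by decide

lemma cover_vec10 : ∀ i, i = (![1, 0] : Fin 2 → Fin 3) 0 ∨ i = (![1, 0] : Fin 2 → Fin 3) 1 ∨
    i = 2 := by decide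

lemma slice_famABC (ψ φ θ : EW W) (w : W) (y : ℤ) :
    slice ![2, 0] y (famABC ψ φ θ w) = fun j => modeMap ψ (-y - 1) (famAB φ θ w j) := by
  funext j
  rw [← vec2_eta j]
  rfl

lemma slice_famAYE (ψ φ θ : EW W) (w : W) (y : ℤ) :
    slice ![2, 0] y (famAYE ψ φ θ w) = fun j => modeMap ψ (-y - 1) (famYE φ θ w j) := by
  funext j
  rw [← vec2_eta j]
  rfl

lemma slice_famAYE_outer (ψ φ θ : EW W) (w : W) (i : ℤ) :
    slice ![1, 0] i (famAYE ψ φ θ w) = famAB ψ (YE φ θ (-i - 1)) w := by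
  funext j
  rw [← vec2_eta j]
  rfl

lemma slice_famYEYE (ψ φ θ : EW W) (w : W) (i : ℤ) :
    slice ![1, 0] i (famYEYE ψ φ θ w) = famYE ψ (YE φ θ (-i - 1)) w := by
  funext j
  rw [← vec2_eta j]
  rfl

lemma lineFinite_map {r : ℕ} {b c : Fin r} {U : Set (Fin r → ℤ)} (L : W →ₗ[ℂ] W)
    {F : (Fin r → ℤ) → W} (hF : F ∈ lineFinite b c U W) :
    (fun j => L (F j)) ∈ lineFinite b c U W := fun k hk =>
  (hF k hk).subset fun _ hm hm' => hm ((congrArg L hm').trans (map_zero L))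

lemma lineSubst_map {r : ℕ} {b c : Fin r} {U : Set (Fin r → ℤ)} (L : W →ₗ[ℂ] W)
    {F : (Fin r → ℤ) → W} (hF : F ∈ lineFinite b c U W) :
    Set.EqOn (lineSubst b c fun j => L (F j)) (fun k => L (lineSubst b c F k)) U := by
  intro k hk
  simp only [lineSubst]
  split_ifs
  · rw [map_finsum L (lineFinite.subst hF hk _ _)]
    simp
  · simp

lemma polyAct_famAYE {φ θ : EW W} (h : QCPair φ θ) (ψ : EW W) {f : MvPolynomial (Fin 2) ℂ}
    {w : W} (hf : polyAct f (famAB φ θ w) ∈ laurentN 2 W) (R : MvPolynomial (Fin 3) ℂ) :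
    polyAct (subPoly 0 2 (R * MvPolynomial.rename ![2, 0] f)) (famAYE ψ φ θ w) =
      lineSubst 0 2 (polyAct (R * MvPolynomial.rename ![2, 0] f) (famABC ψ φ θ w)) := by
  have he := injective_vec20
  have hlf := laurentN_lineFinite (b := 1) (c := 0) (by decide) hf
  have hs : ∀ y, slice ![2, 0] y (polyAct (MvPolynomial.rename ![2, 0] f) (famABC ψ φ θ w)) =
      fun j => modeMap ψ (-y - 1) (polyAct f (famAB φ θ w) j) := fun y => by
    rw [slice_polyAct he, slice_famABC, polyAct_map]
  have hfin : polyAct (MvPolynomial.rename ![2, 0] f) (famABC ψ φ θ w) ∈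
      lineFinite 0 2 Set.univ W := lineFinite_of_slice he cover_vec20 fun k _ => by
    rw [hs]
    exact lineFinite_map _ hlf
  have e : polyAct (subPoly 0 2 (MvPolynomial.rename ![2, 0] f)) (famAYE ψ φ θ w) =
      lineSubst 0 2 (polyAct (MvPolynomial.rename ![2, 0] f) (famABC ψ φ θ w)) := by
    refine (Set.eqOn_univ _ _).1 (eqOn_of_slice cover_vec20 fun k _ => ?_)
    have h1 := subPoly_rename he 1 0 f
    have h2 := slice_lineSubst he (k 1)
      (polyAct (MvPolynomial.rename ![2, 0] f) (famABC ψ φ θ w))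
    have h3 := (Set.eqOn_univ _ _).1 (lineSubst_map (modeMap ψ (-(k 1) - 1)) hlf)
    refine Eq.trans ?_ (h2.trans ((congrArg _ (hs _)).trans h3)).symm
    refine (congrArg (fun p => slice ![2, 0] (k 1) (polyAct p (famAYE ψ φ θ w))) h1).trans ?_
    rw [slice_polyAct he, slice_famAYE, polyAct_map, polyAct_famYE h hf]
  rw [map_mul, polyAct_mul, e, polyAct_mul]
  exact ((Set.eqOn_univ _ _).1
    (lineSubst_polyAct (by decide) (fun _ _ _ => Set.mem_univ _) R hfin)).symm

lemma slice_lineSubst_mem_laurentN {F : (Fin 3 → ℤ) → W} (hF : F ∈ laurentN 3 W) (i : ℤ) :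
    slice ![1, 0] i (lineSubst 0 2 F) ∈ laurentN 2 W := by
  obtain ⟨N, hN⟩ := hF
  refine ⟨min N (2 * N - i), fun j hj => ?_⟩
  simp only [slice, lineSubst]
  split_ifs
  · refine finsum_eq_zero_of_forall_eq_zero fun m => ?_
    rw [hN, smul_zero]
    obtain ⟨l, hl⟩ := hj
    by_cases hm : m < N
    · exact ⟨2, by simpa [insertAt] using hm⟩
    fin_cases l
    · refine ⟨1, ?_⟩
      simp [insertAt] at hl ⊢
      omega
    · refine ⟨0, ?_⟩
      simp [insertAt] at hl ⊢
      omega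
  · rfl

lemma exists_common_poly {ψ φ θ : EW W} (h : QCPair φ θ)
    (hYE : ∀ n, QCPair ψ (YE φ θ n)) (i : ℤ) :
    ∃ q : MvPolynomial (Fin 2) ℂ, q ≠ 0 ∧
      ∀ w, ∀ i' ≤ i, polyAct q (famAB ψ (YE φ θ (-i' - 1)) w) ∈ laurentN 2 W := by
  obtain ⟨N, hN⟩ := exists_YE_eq_zero h
  choose p hp hL using hYE
  refine ⟨∏ l ∈ Finset.Icc N i, p (-l - 1), Finset.prod_ne_zero_iff.2 fun l _ => hp _,
    fun w i' hi => ?_⟩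
  by_cases hi' : i' < N
  · have : famAB ψ (YE φ θ (-i' - 1)) w = 0 := by
      funext k
      simp [famAB, Fab, hN i' hi', mf]
    rw [this, map_zero]
    exact (laurentN 2 W).zero_mem
  · obtain ⟨q, hq⟩ := Finset.dvd_prod_of_mem (fun l => p (-l - 1))
      (Finset.mem_Icc.2 ⟨not_lt.1 hi', hi⟩)
    rw [hq, mul_comm, polyAct_mul]
    exact laurentN_polyAct q ((isLaurent2_mulPoly _ _ _ _).1 (hL _ w))

lemma polyAct_famYEYE {ψ φ θ : EW W} (h : QCPair φ θ) (hYE : ∀ n, QCPair ψ (YE φ θ n)) (w : W)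
    {P : MvPolynomial (Fin 3) ℂ}
    (hP : ∀ i, slice ![1, 0] i (polyAct P (famAYE ψ φ θ w)) ∈ laurentN 2 W) :
    polyAct (subPoly 0 1 P) (famYEYE ψ φ θ w) =
      lineSubst 0 1 (polyAct P (famAYE ψ φ θ w)) := by
  have he := injective_vec10
  have h10 : (1 : Fin 2) ≠ 0 := by decide
  have h01 : (0 : Fin 3) ≠ 1 := by decide
  refine (Set.eqOn_univ _ _).1 (eqOn_of_slice cover_vec10 fun k _ => ?_)
  generalize k 2 = i
  obtain ⟨q, hq0, hq⟩ := exists_common_poly h hYE i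
  set U : Set (Fin 3 → ℤ) := {k | k 2 ≤ i}
  have hU : ∀ k ∈ U, ∀ l, k - unitVec l ∈ U := fun k hk l => by
    have : 0 ≤ unitVec l (2 : Fin 3) := by fin_cases l <;> simp
    have hk : k 2 ≤ i := hk
    change k 2 - unitVec l 2 ≤ i
    omega
  set Q : MvPolynomial (Fin 3) ℂ := MvPolynomial.rename ![1, 0] q
  have hQs : subPoly 0 1 Q = MvPolynomial.rename ![1, 0] (subPoly 1 0 q) := subPoly_rename he 1 0 q
  have hfin : ∀ {F : (Fin 3 → ℤ) → W}, (∀ l ≤ i, slice ![1, 0] l F ∈ laurentN 2 W) →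
      F ∈ lineFinite 0 1 U W := fun hF =>
    lineFinite_of_slice he cover_vec10 fun k hk => laurentN_lineFinite h10 (hF _ hk)
  have hQ1 : ∀ l, slice ![1, 0] l (polyAct Q (famAYE ψ φ θ w)) =
      polyAct q (famAB ψ (YE φ θ (-l - 1)) w) := fun l => by
    rw [slice_polyAct he, slice_famAYE_outer]
  have hQ2 : Set.EqOn (polyAct (subPoly 0 1 Q) (famYEYE ψ φ θ w))
      (lineSubst 0 1 (polyAct Q (famAYE ψ φ θ w))) U := by
    refine eqOn_of_slice cover_vec10 fun k hk => ?_
    have h2 := slice_lineSubst he (k 2) (polyAct Q (famAYE ψ φ θ w))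
    refine Eq.trans ?_ h2.symm
    rw [hQ1, hQs, slice_polyAct he, slice_famYEYE, polyAct_famYE (hYE _) (hq w _ hk)]
  have hmain : Set.EqOn (polyAct (subPoly 0 1 Q) (polyAct (subPoly 0 1 P) (famYEYE ψ φ θ w)))
      (polyAct (subPoly 0 1 Q) (lineSubst 0 1 (polyAct P (famAYE ψ φ θ w)))) U := by
    rw [polyAct_comm]
    refine (polyAct_congr hU _ hQ2).trans ?_
    refine (lineSubst_polyAct h01 hU P
      (hfin fun l hl => by rw [hQ1]; exact hq w l hl)).symm.trans ?_
    rw [polyAct_comm]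
    exact lineSubst_polyAct h01 hU Q (hfin fun l _ => hP l)
  refine polyAct_injOn_iterLaurent (subPoly_ne_zero h10 hq0) ?_ ?_ ?_
  · refine slice_polyAct_mem_iterLaurent he cover_vec10 (by decide) _ (fun y => ?_) i
    rw [slice_famYEYE]
    exact famYE_mem_iterLaurent (hYE _) w
  · have h2 := slice_lineSubst he i (polyAct P (famAYE ψ φ θ w))
    exact Eq.mpr (congrArg (· ∈ iterLaurent W) h2) (lineSubst_mem_iterLaurent (hP i))
  · rw [← slice_polyAct he, ← slice_polyAct he, ← hQs]
    exact funext fun j => hmain (show insertAt ![1, 0] i j 2 ≤ i by simp [insertAt])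

/-- The polynomial `f(y,x) f(y,z) f(z,x)` in the variables `(x, y, z)`. -/
def P3xyz (f : MvPolynomial (Fin 2) ℂ) : MvPolynomial (Fin 3) ℂ :=
  MvPolynomial.rename ![1, 0] f * MvPolynomial.rename ![1, 2] f * MvPolynomial.rename ![2, 0] f

lemma P3hyp_eq_P3con (f : MvPolynomial (Fin 2) ℂ) : P3hyp f = P3con f := by
  rw [P3hyp, P3con]; ring

lemma subPoly_P3xyz (f : MvPolynomial (Fin 2) ℂ) :
    subPoly 0 1 (subPoly 0 2 (P3xyz f)) = Gpoly f := by
  have h : ∀ e : Fin 2 → Fin 3, subPoly 0 1 (subPoly 0 2 (MvPolynomial.rename e f)) =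
      MvPolynomial.aeval (fun i => subPoly 0 1 (subPoly 0 2 (MvPolynomial.X (e i)))) f := by
    intro e
    have : ((subPoly 0 1).comp (subPoly 0 2)).comp (MvPolynomial.rename e) =
        MvPolynomial.aeval (fun i => subPoly 0 1 (subPoly 0 2 (MvPolynomial.X (e i)))) := by
      ext1 i; simp
    exact DFunLike.congr_fun this f
  have h1 : ∀ a b : Fin 3, (fun i => subPoly 0 1 (subPoly 0 2
      (MvPolynomial.X ((![a, b] : Fin 2 → Fin 3) i)))) =
      ![subPoly 0 1 (subPoly 0 2 (MvPolynomial.X a)),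
        subPoly 0 1 (subPoly 0 2 (MvPolynomial.X b))] := by
    intro a b; funext i; fin_cases i <;> rfl
  have hx : subPoly (0 : Fin 3) 1 (subPoly 0 2 (MvPolynomial.X 0)) = MvPolynomial.X 0 := by
    simp [subPoly]
  have hy : subPoly (0 : Fin 3) 1 (subPoly 0 2 (MvPolynomial.X 1)) =
      MvPolynomial.X 0 + MvPolynomial.X 1 := by
    simp [subPoly]
  have hz : subPoly (0 : Fin 3) 1 (subPoly 0 2 (MvPolynomial.X 2)) =
      MvPolynomial.X 0 + MvPolynomial.X 2 := by
    simp [subPoly]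
  simp only [P3xyz, Gpoly, map_mul, h, h1, hx, hy, hz]
  ring

lemma polyAct_famABC (f : MvPolynomial (Fin 2) ℂ) (ψ φ θ : EW W) (w : W) :
    polyAct (P3xyz f) (famABC ψ φ θ w) =
      fun k => mulPolyN (P3con f) (seqCoeff ![ψ, φ, θ] w) ![k 1, k 2, k 0] := by
  have h := polyAct_comp ![2, 0, 1] (fun k : Fin 3 → ℤ => ![k 1, k 2, k 0])
    (fun k i => by funext l; fin_cases i <;> fin_cases l <;> simp) (P3xyz f)
    (seqCoeff ![ψ, φ, θ] w)
  have hP : MvPolynomial.rename ![2, 0, 1] (P3xyz f) = P3con f := by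
    have hc : ∀ a b : Fin 3, (![2, 0, 1] : Fin 3 → Fin 3) ∘ ![a, b] =
        ![(![2, 0, 1] : Fin 3 → Fin 3) a, (![2, 0, 1] : Fin 3 → Fin 3) b] := by decide
    simp only [P3xyz, P3con, map_mul, MvPolynomial.rename_rename, hc]
    simp only [Matrix.cons_val]
    ring
  rw [hP] at h
  rw [mulPolyN_eq]
  exact h

/-- cf. Lemma 2.8 / `lclosed`.  Let `V ⊆ ℰ(W)` be a subspace all
of whose sequences of length 2 and 3 are quasi compatible and which is closed, let
`ψ, φ, θ ∈ V` and let `f(x,y)` be a nonzero polynomial with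
`f(x,y)φ(x)θ(y) ∈ Hom(W,W((x,y)))` and
`f(x,y)f(x,z)f(y,z)ψ(x)φ(y)θ(z) ∈ Hom(W,W((x,y,z)))`.  Then
`f(x+x₁,x) f(x+x₂,x) f(x+x₁,x+x₂) Y_ℰ(ψ(x),x₁) Y_ℰ(φ(x),x₂) θ(x)
 = (f(y,x)f(z,x)f(y,z) ψ(y)φ(z)θ(x))|_{y=x+x₁, z=x+x₂}`,
stated coefficientwise: index `k 0 ↔ x`, `k 1 ↔ x₁`, `k 2 ↔ x₂` on the left;
on the right the substitution is expanded in nonnegative powers of `x₁, x₂`. -/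
theorem statement6 {W : Type*} [AddCommGroup W] [Module ℂ W]
    (V : Submodule ℂ (EW W))
    (h2 : ∀ ψ : Fin 2 → EW W, (∀ i, ψ i ∈ V) → QCSeq ψ)
    (h3 : ∀ ψ : Fin 3 → EW W, (∀ i, ψ i ∈ V) → QCSeq ψ)
    (hclosed : ∀ a ∈ V, ∀ b ∈ V, ∀ n : ℤ, YE a b n ∈ V)
    (ψ φ θ : EW W) (hψ : ψ ∈ V) (hφ : φ ∈ V) (hθ : θ ∈ V)
    (f : MvPolynomial (Fin 2) ℂ) (hf : f ≠ 0)
    (hf1 : ∀ w, IsLaurent2 (mulPoly f (Fab φ θ w)))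
    (hf2 : ∀ w, IsLaurentN (mulPolyN (P3hyp f) (seqCoeff ![ψ, φ, θ] w))) :
    ∀ (w : W) (k : Fin 3 → ℤ),
      mulPolyN (Gpoly f)
        (fun k' => mf (YE ψ (YE φ θ (-(k' 2) - 1)) (-(k' 1) - 1)) w (-(k' 0) - 1)) k =
      (if 0 ≤ k 1 ∧ 0 ≤ k 2 then
        ∑ᶠ my : ℤ, ∑ᶠ mz : ℤ, (binom my (k 1).toNat * binom mz (k 2).toNat) •
          mulPolyN (P3con f) (seqCoeff ![ψ, φ, θ] w)
            ![my, mz, k 0 - (my - k 1) - (mz - k 2)]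
       else 0) := by
  intro w k
  have hqc : ∀ a ∈ V, ∀ b ∈ V, QCPair a b := fun a ha b hb =>
    (h2 ![a, b] fun i => by fin_cases i <;> assumption).qcPair
  have hA := polyAct_famABC f ψ φ θ w
  have hAL : polyAct (P3xyz f) (famABC ψ φ θ w) ∈ laurentN 3 W := by
    obtain ⟨N, hN⟩ := hf2 w
    rw [P3hyp_eq_P3con] at hN
    refine ⟨N, fun k ⟨i, hi⟩ => ?_⟩
    rw [hA]
    refine hN _ ⟨![2, 0, 1] i, ?_⟩
    fin_cases i <;> exact hi
  have hB := polyAct_famAYE (hqc φ hφ θ hθ) ψ ((isLaurent2_mulPoly f φ θ w).1 (hf1 w))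
    (MvPolynomial.rename ![1, 0] f * MvPolynomial.rename ![1, 2] f)
  change polyAct (subPoly 0 2 (P3xyz f)) _ = lineSubst 0 2 (polyAct (P3xyz f) _) at hB
  have hC := polyAct_famYEYE (hqc φ hφ θ hθ)
    (fun n => hqc ψ hψ _ (hclosed φ hφ θ hθ n)) w (P := subPoly 0 2 (P3xyz f))
    fun i => hB ▸ slice_lineSubst_mem_laurentN hAL i
  rw [subPoly_P3xyz, hB, hA] at hC
  rw [mulPolyN_eq]
  refine (congrFun hC k).trans ?_
  have e1 : ∀ my, (k + (my - k 1) • lineVec (0 : Fin 3) 1) 2 = k 2 := fun my => by simp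
  simp only [lineSubst, e1]
  by_cases hk1 : 0 ≤ k 1
  · by_cases hk2 : 0 ≤ k 2
    · rw [if_pos hk1, if_pos ⟨hk1, hk2⟩]
      refine finsum_congr fun my => ?_
      rw [if_pos hk2, smul_finsum]
      refine finsum_congr fun mz => ?_
      rw [mul_smul]
      congr 3
      funext l
      fin_cases l
      · simp
      · simp
      · simp; ring
    · rw [if_pos hk1, if_neg fun h => hk2 h.2]
      exact finsum_eq_zero_of_forall_eq_zero fun my => by rw [if_neg hk2, smul_zero]
  · rw [if_neg hk1, if_neg fun h => hk1 h.1]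

end NVA
end
end

section
/- Let W be a vector space over ℂ and let ψ₁(x),…,ψ_r(x), a(x), b(x), φ₁(x),…,φ_s(x) ∈ ℰ(W). Assume that the ordered pair (a(x), b(x)) and the ordered sequence (ψ₁(x),…,ψ_r(x), a(x), b(x), φ₁(x),…,φ_s(x)) are quasi compatible. Then for any n ∈ ℤ, the ordered sequence (ψ₁(x),…,ψ_r(x), a(x)_n b(x), φ₁(x),…,φ_s(x)) is quasi compatible. -/
noncomputable section

open Classical

namespace NVA

section PolynomialAction

variable {W : Type*} [AddCommGroup W] [Module ℂ W] {N N' : ℕ}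

lemma mulPolyN_eq_sum_of_subset {P : MvPolynomial (Fin N) ℂ} {S : Finset (Fin N →₀ ℕ)}
    (h : P.support ⊆ S) (F : (Fin N → ℤ) → W) (k : Fin N → ℤ) :
    mulPolyN P F k = ∑ d ∈ S, MvPolynomial.coeff d P • F (fun i => k i - d i) := by
  refine Finset.sum_subset h fun d _ hd => ?_
  rw [MvPolynomial.notMem_support_iff.mp hd, zero_smul]

lemma mulPolyN_monomial (d : Fin N →₀ ℕ) (c : ℂ) (F : (Fin N → ℤ) → W) (k : Fin N → ℤ) :
    mulPolyN (MvPolynomial.monomial d c) F k = c • F (fun i => k i - d i) := by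
  rw [mulPolyN_eq_sum_of_subset (S := {d}) MvPolynomial.support_monomial_subset]
  simp

lemma mulPolyN_add_left (P Q : MvPolynomial (Fin N) ℂ) (F : (Fin N → ℤ) → W) :
    mulPolyN (P + Q) F = mulPolyN P F + mulPolyN Q F := by
  funext k
  rw [Pi.add_apply, mulPolyN_eq_sum_of_subset (S := P.support ∪ Q.support)
      MvPolynomial.support_add,
    mulPolyN_eq_sum_of_subset (P := P) (S := P.support ∪ Q.support) Finset.subset_union_left,
    mulPolyN_eq_sum_of_subset (P := Q) (S := P.support ∪ Q.support) Finset.subset_union_right,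
    ← Finset.sum_add_distrib]
  exact Finset.sum_congr rfl fun d _ => by rw [MvPolynomial.coeff_add, add_smul]

/-- Multiplication of a family by a polynomial, as an additive map in the polynomial. -/
def mulPolyNLeft (F : (Fin N → ℤ) → W) : MvPolynomial (Fin N) ℂ →+ ((Fin N → ℤ) → W) where
  toFun P := mulPolyN P F
  map_zero' := by funext k; simp [mulPolyN]
  map_add' P Q := mulPolyN_add_left P Q F

lemma mulPolyN_add_right (P : MvPolynomial (Fin N) ℂ) (F G : (Fin N → ℤ) → W) :
    mulPolyN P (F + G) = mulPolyN P F + mulPolyN P G := by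
  funext k
  simp [mulPolyN, Finset.sum_add_distrib]

lemma mulPolyN_smul_right (P : MvPolynomial (Fin N) ℂ) (c : ℂ) (F : (Fin N → ℤ) → W) :
    mulPolyN P (c • F) = c • mulPolyN P F := by
  funext k
  simp [mulPolyN, Finset.smul_sum, smul_comm c]

lemma mulPolyN_sum_right {κ : Type*} (s : Finset κ) (P : MvPolynomial (Fin N) ℂ)
    (F : κ → (Fin N → ℤ) → W) :
    mulPolyN P (∑ x ∈ s, F x) = ∑ x ∈ s, mulPolyN P (F x) :=
  map_sum (AddMonoidHom.mk' (mulPolyN P) (mulPolyN_add_right P)) F s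

lemma mulPolyN_C (c : ℂ) (F : (Fin N → ℤ) → W) : mulPolyN (MvPolynomial.C c) F = c • F := by
  funext k
  rw [MvPolynomial.C_apply, mulPolyN_monomial]
  simp

lemma mulPolyN_X (j : Fin N) (F : (Fin N → ℤ) → W) (k : Fin N → ℤ) :
    mulPolyN (MvPolynomial.X j) F k = F (k - Pi.single j 1) := by
  rw [MvPolynomial.X, mulPolyN_monomial, one_smul]
  congr 1
  funext i
  simp [Finsupp.single_apply, Pi.single_apply, eq_comm]

lemma mulPolyN_mul (P Q : MvPolynomial (Fin N) ℂ) (F : (Fin N → ℤ) → W) :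
    mulPolyN (P * Q) F = mulPolyN P (mulPolyN Q F) := by
  induction P using MvPolynomial.induction_on' with
  | add P₁ P₂ h₁ h₂ => rw [add_mul, mulPolyN_add_left, mulPolyN_add_left, h₁, h₂]
  | monomial d c =>
    induction Q using MvPolynomial.induction_on' with
    | add Q₁ Q₂ h₁ h₂ =>
      rw [mul_add, mulPolyN_add_left, mulPolyN_add_left, h₁, h₂, mulPolyN_add_right]
    | monomial e c' =>
      funext k
      rw [MvPolynomial.monomial_mul, mulPolyN_monomial, mulPolyN_monomial, mulPolyN_monomial,
        mul_smul]
      congr 3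
      funext i
      simp [sub_sub]

lemma mulPolyN_rename (g : Fin N' → Fin N) (p : MvPolynomial (Fin N') ℂ)
    (F : (Fin N → ℤ) → W) (k : Fin N → ℤ) :
    mulPolyN (MvPolynomial.rename g p) F k =
      ∑ d ∈ p.support, MvPolynomial.coeff d p • F (fun i => k i - d.mapDomain g i) := by
  conv_lhs => rw [p.as_sum]
  rw [map_sum]
  change mulPolyNLeft F _ k = _
  rw [map_sum, Finset.sum_apply]
  refine Finset.sum_congr rfl fun d _ => ?_
  rw [MvPolynomial.rename_monomial]
  exact mulPolyN_monomial _ _ _ _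

lemma mulPolyN_mem (S : Submodule ℂ ((Fin N → ℤ) → W))
    (hS : ∀ j, ∀ F ∈ S, mulPolyN (MvPolynomial.X j) F ∈ S)
    (P : MvPolynomial (Fin N) ℂ) {F : (Fin N → ℤ) → W} (hF : F ∈ S) : mulPolyN P F ∈ S := by
  induction P using MvPolynomial.induction_on generalizing F with
  | C c => rw [mulPolyN_C]; exact S.smul_mem c hF
  | add P Q hP hQ => rw [mulPolyN_add_left]; exact S.add_mem (hP hF) (hQ hF)
  | mul_X P j hP => rw [mulPolyN_mul]; exact hP (hS j F hF)

/-- An operator intertwining multiplication by the variables intertwines multiplication by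
polynomials. -/
lemma map_mulPolyN (π : Fin N → Fin N') (S : Submodule ℂ ((Fin N → ℤ) → W))
    (hS : ∀ j, ∀ F ∈ S, mulPolyN (MvPolynomial.X j) F ∈ S)
    (Φ : ((Fin N → ℤ) → W) → ((Fin N' → ℤ) → W))
    (hadd : ∀ F ∈ S, ∀ G ∈ S, Φ (F + G) = Φ F + Φ G)
    (hsmul : ∀ (c : ℂ), ∀ F ∈ S, Φ (c • F) = c • Φ F)
    (hX : ∀ j, ∀ F ∈ S, Φ (mulPolyN (MvPolynomial.X j) F) =
      mulPolyN (MvPolynomial.X (π j)) (Φ F))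
    (P : MvPolynomial (Fin N) ℂ) {F : (Fin N → ℤ) → W} (hF : F ∈ S) :
    Φ (mulPolyN P F) = mulPolyN (MvPolynomial.rename π P) (Φ F) := by
  induction P using MvPolynomial.induction_on generalizing F with
  | C c => rw [MvPolynomial.rename_C, mulPolyN_C, mulPolyN_C, hsmul c F hF]
  | add P Q hP hQ =>
    rw [mulPolyN_add_left, hadd _ (mulPolyN_mem S hS P hF) _ (mulPolyN_mem S hS Q hF), hP hF,
      hQ hF, map_add, mulPolyN_add_left]
  | mul_X P j hP =>
    rw [mulPolyN_mul, hP (hS j F hF), hX j F hF, map_mul, MvPolynomial.rename_X, mulPolyN_mul]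

end PolynomialAction

section Laurent

variable {W : Type*} [AddCommGroup W] [Module ℂ W] {N : ℕ}

variable (W N) in
/-- The space `W((x₁,…,x_N))` of families. -/
def laurentSubmodule : Submodule ℂ ((Fin N → ℤ) → W) where
  carrier := {F | IsLaurentN F}
  zero_mem' := ⟨0, fun _ _ => rfl⟩
  add_mem' := by
    rintro F G ⟨A, hA⟩ ⟨B, hB⟩
    refine ⟨min A B, fun k ⟨i, hi⟩ => ?_⟩
    rw [Pi.add_apply, hA k ⟨i, by omega⟩, hB k ⟨i, by omega⟩, add_zero]
  smul_mem' := by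
    rintro c F ⟨A, hA⟩
    exact ⟨A, fun k hk => by rw [Pi.smul_apply, hA k hk, smul_zero]⟩

lemma IsLaurentN.mulPolyN {F : (Fin N → ℤ) → W} (hF : IsLaurentN F)
    (P : MvPolynomial (Fin N) ℂ) : IsLaurentN (NVA.mulPolyN P F) := by
  refine mulPolyN_mem (laurentSubmodule W N) ?_ P hF
  rintro j F ⟨A, hA⟩
  refine ⟨A, fun k ⟨i, hi⟩ => ?_⟩
  rw [mulPolyN_X]
  refine hA _ ⟨i, ?_⟩
  by_cases h : i = j
  · subst h; simp; omega
  · simpa [h] using hi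

variable (W) in
/-- The space of families whose restriction to any fixed exponents of the variables other than
`x_u` and `x_v` lies in `W((x_u,x_v))`. -/
def laurentPairSubmodule (u v : Fin N) : Submodule ℂ ((Fin N → ℤ) → W) where
  carrier := {F | ∀ k : Fin N → ℤ, ∃ A : ℤ, ∀ l : Fin N → ℤ,
    (∀ i, i ≠ u → i ≠ v → l i = k i) → (l u < A ∨ l v < A) → F l = 0}
  zero_mem' := fun _ => ⟨0, fun _ _ _ => rfl⟩
  add_mem' := by
    intro F G hF hG k
    obtain ⟨A, hA⟩ := hF k
    obtain ⟨B, hB⟩ := hG k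
    refine ⟨min A B, fun l hl h => ?_⟩
    rw [Pi.add_apply, hA l hl (by omega), hB l hl (by omega), add_zero]
  smul_mem' := by
    intro c F hF k
    obtain ⟨A, hA⟩ := hF k
    exact ⟨A, fun l hl h => by rw [Pi.smul_apply, hA l hl h, smul_zero]⟩

lemma mulPolyN_X_mem_laurentPair {u v : Fin N} (j : Fin N) (F : (Fin N → ℤ) → W)
    (hF : F ∈ laurentPairSubmodule W u v) :
    mulPolyN (MvPolynomial.X j) F ∈ laurentPairSubmodule W u v := by
  intro k
  obtain ⟨A, hA⟩ := hF (k - Pi.single j 1)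
  refine ⟨A, fun l hl h => ?_⟩
  rw [mulPolyN_X]
  have hs : ∀ i, (0 : ℤ) ≤ (Pi.single j 1 : Fin N → ℤ) i := fun i => by
    by_cases h : i = j
    · subst h; simp
    · simp [h]
  refine hA _ (fun i hu hv => by simp [hl i hu hv]) ?_
  have := hs u
  have := hs v
  simp only [Pi.sub_apply]
  omega

lemma mulPolyN_mem_laurentPair {u v : Fin N} (P : MvPolynomial (Fin N) ℂ)
    {F : (Fin N → ℤ) → W} (hF : F ∈ laurentPairSubmodule W u v) :
    mulPolyN P F ∈ laurentPairSubmodule W u v :=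
  mulPolyN_mem _ mulPolyN_X_mem_laurentPair P hF

lemma laurentPairSubmodule_comm (u v : Fin N) :
    laurentPairSubmodule W u v = laurentPairSubmodule W v u := by
  ext F
  refine forall_congr' fun k => exists_congr fun A => forall_congr' fun l => ?_
  rw [or_comm]
  exact imp_congr_left ⟨fun h i hu hv => h i hv hu, fun h i hu hv => h i hv hu⟩

end Laurent

section TorsionFree

variable {W : Type*} [AddCommGroup W] [Module ℂ W] {N : ℕ}

/-- A lower bound on the `x_u`-order of `P F`, where `P` only involves `x_u` and `x_v`, bounds the
`x_u`-order of `F` from below. -/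
lemma exists_forall_eq_zero_of_mulPolyN {u v : Fin N} {P : MvPolynomial (Fin N) ℂ} (hP : P ≠ 0)
    (hsupp : ∀ d ∈ P.support, ∀ i, i ≠ u → i ≠ v → d i = 0) :
    ∃ e : ℤ, ∀ F ∈ laurentPairSubmodule W u v, ∀ (k : Fin N → ℤ) (B : ℤ),
      (∀ l : Fin N → ℤ, (∀ i, i ≠ u → i ≠ v → l i = k i) → l u < B → mulPolyN P F l = 0) →
      ∀ l : Fin N → ℤ, (∀ i, i ≠ u → i ≠ v → l i = k i) → l u < B - e → F l = 0 := by
  obtain ⟨d₀, hd₀, hmin⟩ := Finset.exists_min_image P.support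
    (fun d => toLex (d u, d v)) (MvPolynomial.support_nonempty.mpr hP)
  refine ⟨d₀ u, fun F hF k B hB => ?_⟩
  obtain ⟨A, hA⟩ := hF k
  have outer : ∀ (n : ℕ) (l : Fin N → ℤ), (∀ i, i ≠ u → i ≠ v → l i = k i) →
      l u < B - d₀ u → l u < A + n → F l = 0 := by
    intro n
    induction n with
    | zero => intro l hl _ h; exact hA l hl (Or.inl (by simpa using h))
    | succ n ih =>
      have inner : ∀ (n' : ℕ) (l : Fin N → ℤ), (∀ i, i ≠ u → i ≠ v → l i = k i) →
          l u < B - d₀ u → l u < A + (n + 1 : ℕ) → l v < A + n' → F l = 0 := by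
        intro n'
        induction n' with
        | zero => intro l hl _ _ h; exact hA l hl (Or.inr (by simpa using h))
        | succ n' ih' =>
          intro l hl hlB hlu hlv
          have key := hB (fun i => l i + d₀ i)
            (fun i hu hv => by simp [hsupp d₀ hd₀ i hu hv, hl i hu hv]) (by omega)
          rw [mulPolyN, Finset.sum_eq_single d₀] at key
          · simpa [MvPolynomial.mem_support_iff.mp hd₀] using key
          · intro d hd hne
            have hag : ∀ i, i ≠ u → i ≠ v → l i + (d₀ i : ℤ) - (d i : ℤ) = k i :=
              fun i hu hv => by simp [hsupp d₀ hd₀ i hu hv, hsupp d hd i hu hv, hl i hu hv]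
            have hle := hmin d hd
            rw [Prod.Lex.toLex_le_toLex] at hle
            have h0 : F (fun i => l i + (d₀ i : ℤ) - (d i : ℤ)) = 0 := by
              rcases hle with h | ⟨h₁, h₂⟩
              · simp only at h
                refine ih _ hag ?_ ?_ <;> push_cast at * <;> omega
              · simp only at h₁ h₂
                have h₃ : d₀ v ≠ d v := by
                  intro h₃
                  apply hne
                  ext i
                  by_cases hu : i = u
                  · rw [hu, h₁]
                  · by_cases hv : i = v
                    · rw [hv, h₃]
                    · rw [hsupp d hd i hu hv, hsupp d₀ hd₀ i hu hv]
                refine ih' _ hag ?_ ?_ ?_ <;> push_cast at * <;> omega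
            rw [h0, smul_zero]
          · exact fun h => absurd hd₀ h
      intro l hl hlB hlu
      exact inner (l v + 1 - A).toNat l hl hlB hlu (by omega)
  intro l hl hlB
  exact outer (l u + 1 - A).toNat l hl hlB (by omega)

lemma IsLaurentN.of_mulPolyN {u v : Fin N} {P : MvPolynomial (Fin N) ℂ} (hP : P ≠ 0)
    (hsupp : ∀ d ∈ P.support, ∀ i, i ≠ u → i ≠ v → d i = 0) {F : (Fin N → ℤ) → W}
    (hF : F ∈ laurentPairSubmodule W u v) (h : IsLaurentN (NVA.mulPolyN P F)) :
    IsLaurentN F := by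
  obtain ⟨e, he⟩ := exists_forall_eq_zero_of_mulPolyN (W := W) hP hsupp
  obtain ⟨e', he'⟩ := exists_forall_eq_zero_of_mulPolyN (W := W) (u := v) (v := u) hP
    (fun d hd i hv hu => hsupp d hd i hu hv)
  obtain ⟨A, hA⟩ := h
  refine ⟨min A (min (A - e) (A - e')), fun k ⟨i, hi⟩ => ?_⟩
  by_cases hu : i = u
  · subst hu
    exact he F hF k A (fun l _ hl => hA l ⟨i, hl⟩) k (fun _ _ _ => rfl) (by omega)
  by_cases hv : i = v
  · subst hv
    exact he' F (laurentPairSubmodule_comm (W := W) u i ▸ hF) k A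
      (fun l _ hl => hA l ⟨i, hl⟩) k (fun _ _ _ => rfl) (by omega)
  · exact he F hF k (k u + e + 1)
      (fun l hl _ => hA l ⟨i, by rw [hl i hu hv]; omega⟩) k (fun _ _ _ => rfl) (by omega)

end TorsionFree

section Derivative

variable {W : Type*} [AddCommGroup W] [Module ℂ W] {N : ℕ}

/-- The partial derivative `∂/∂x_u` of a family. -/
def partialFam (u : Fin N) (F : (Fin N → ℤ) → W) : (Fin N → ℤ) → W :=
  fun k => ((k u : ℂ) + 1) • F (k + Pi.single u 1)

lemma partialFam_mulPolyN (u : Fin N) (P : MvPolynomial (Fin N) ℂ) (F : (Fin N → ℤ) → W) :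
    partialFam u (mulPolyN P F) =
      mulPolyN (MvPolynomial.pderiv u P) F + mulPolyN P (partialFam u F) := by
  have hadd : ∀ F G : (Fin N → ℤ) → W, partialFam u (F + G) = partialFam u F + partialFam u G :=
    fun F G => by funext k; simp [partialFam]
  induction P using MvPolynomial.induction_on generalizing F with
  | C c =>
    rw [MvPolynomial.pderiv_C, mulPolyN_C, mulPolyN_C]
    funext k
    simp [partialFam, mulPolyN, smul_comm c]
  | add P Q hP hQ =>
    rw [mulPolyN_add_left, hadd, hP, hQ, map_add, mulPolyN_add_left, mulPolyN_add_left]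
    abel
  | mul_X P j hP =>
    have hX : partialFam u (mulPolyN (MvPolynomial.X j) F) =
        mulPolyN (MvPolynomial.pderiv u (MvPolynomial.X j)) F +
          mulPolyN (MvPolynomial.X j) (partialFam u F) := by
      by_cases hj : j = u
      · subst hj
        rw [MvPolynomial.pderiv_X_self, ← MvPolynomial.C_1, mulPolyN_C]
        funext k
        rw [Pi.add_apply, mulPolyN_X]
        simp only [partialFam, mulPolyN_X, one_smul, Pi.smul_apply, add_sub_cancel_right,
          sub_add_cancel, Pi.sub_apply, Pi.single_eq_same]
        push_cast
        rw [add_comm (k j : ℂ) 1, add_smul, one_smul, sub_add_cancel]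
      · rw [MvPolynomial.pderiv_X_of_ne hj, ← MvPolynomial.C_0, mulPolyN_C, zero_smul, zero_add]
        funext k
        rw [mulPolyN_X]
        simp only [partialFam, mulPolyN_X, Pi.sub_apply, Pi.single_eq_of_ne (Ne.symm hj), sub_zero]
        rw [sub_add_eq_add_sub]
    rw [mulPolyN_mul, hP, hX, Derivation.leibniz, mulPolyN_add_right, mulPolyN_add_left,
      mulPolyN_mul, smul_eq_mul, smul_eq_mul, mulPolyN_mul, mul_comm, mulPolyN_mul]
    abel

lemma iterate_partialFam (u : Fin N) (j : ℕ) (F : (Fin N → ℤ) → W) (k : Fin N → ℤ) :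
    (partialFam u)^[j] F k =
      (∏ i ∈ Finset.range j, ((k u : ℂ) + j - i)) • F (k + Pi.single u (j : ℤ)) := by
  induction j generalizing F with
  | zero => simp
  | succ j ih =>
    have hk : k + Pi.single u (j : ℤ) + Pi.single u 1 = k + Pi.single u ((j + 1 : ℕ) : ℤ) := by
      rw [add_assoc, ← Pi.single_add]; push_cast; rfl
    have hc : (∏ i ∈ Finset.range j, ((k u : ℂ) + j - i)) *
        (((k + Pi.single u (j : ℤ) : Fin N → ℤ) u : ℂ) + 1) =
        ∏ i ∈ Finset.range (j + 1), ((k u : ℂ) + (j + 1 : ℕ) - i) := by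
      rw [Finset.prod_range_succ', Pi.add_apply, Pi.single_eq_same]
      refine congrArg₂ (· * ·) (Finset.prod_congr rfl fun i _ => ?_) ?_ <;> push_cast <;> ring
    rw [Function.iterate_succ_apply, ih, partialFam, smul_smul, hk, hc]

lemma isLaurentN_pow_mulPolyN_iterate_partialFam (u : Fin N) {R : MvPolynomial (Fin N) ℂ}
    {F : (Fin N → ℤ) → W} (h : IsLaurentN (mulPolyN R F)) (j : ℕ) :
    IsLaurentN (mulPolyN (R ^ (j + 1)) ((partialFam u)^[j] F)) := by
  have hD : ∀ G : (Fin N → ℤ) → W, IsLaurentN G → IsLaurentN (partialFam u G) := by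
    rintro G ⟨A, hA⟩
    refine ⟨A - 1, fun k ⟨i, hi⟩ => ?_⟩
    rw [partialFam, hA _ ⟨i, ?_⟩, smul_zero]
    by_cases hu : i = u
    · subst hu; simp; omega
    · simp [hu]; omega
  induction j with
  | zero => simpa using h
  | succ j ih =>
    rw [Function.iterate_succ_apply']
    set G := (partialFam u)^[j] F
    have h₁ : mulPolyN (R ^ (j + 1 + 1)) (partialFam u G) =
        mulPolyN R (partialFam u (mulPolyN (R ^ (j + 1)) G)) +
          mulPolyN (-((j + 1 : ℕ) • MvPolynomial.pderiv u R)) (mulPolyN (R ^ (j + 1)) G) := by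
      rw [partialFam_mulPolyN, mulPolyN_add_right, ← mulPolyN_mul, ← mulPolyN_mul, ← mulPolyN_mul,
        add_right_comm (mulPolyN _ _), ← mulPolyN_add_left, Derivation.leibniz_pow, ← pow_succ']
      have h₂ : R * ((j + 1) • R ^ (j + 1 - 1) • MvPolynomial.pderiv u R) +
          -((j + 1) • MvPolynomial.pderiv u R) * R ^ (j + 1) = 0 := by
        simp only [Nat.add_sub_cancel, smul_eq_mul, nsmul_eq_mul]
        ring
      rw [h₂, ← MvPolynomial.C_0, mulPolyN_C, zero_smul, zero_add]
    rw [h₁]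
    exact (laurentSubmodule W N).add_mem ((hD _ ih).mulPolyN _) (ih.mulPolyN _)

lemma iterate_partialFam_mem_laurentPair {u v : Fin N} (huv : u ≠ v) {F : (Fin N → ℤ) → W}
    (hF : F ∈ laurentPairSubmodule W u v) (j : ℕ) :
    (partialFam u)^[j] F ∈ laurentPairSubmodule W u v := by
  induction j with
  | zero => exact hF
  | succ j ih =>
    rw [Function.iterate_succ_apply']
    intro k
    obtain ⟨A, hA⟩ := ih k
    refine ⟨A - 1, fun l hl h => ?_⟩
    rw [partialFam, hA _ (fun i hu hv => by simp [hu, hl i hu hv]) ?_, smul_zero]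
    simp only [Pi.add_apply, Pi.single_eq_same, Pi.single_eq_of_ne huv.symm]
    omega

end Derivative

section Merge

variable {W : Type*} [AddCommGroup W] [Module ℂ W] {N N' : ℕ}

/-- `π` identifies `u` with `v` and nothing else. -/
structure IsMerge (π : Fin N → Fin N') (u v : Fin N) : Prop where
  ne : u ≠ v
  map_eq : π u = π v
  inj : ∀ i j, π i = π j → i ≠ u → i ≠ v → i = j
  surj : Function.Surjective π

/-- The exponents over `k` in which `x_u` has exponent `m`. -/
def splitIdx (π : Fin N → Fin N') (u v : Fin N) (k : Fin N' → ℤ) (m : ℤ) : Fin N → ℤ :=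
  fun i => if i = u then m else if i = v then k (π v) - m else k (π i)

/-- The substitution `x_u = x_v`. -/
def mergeFam (π : Fin N → Fin N') (u v : Fin N) (F : (Fin N → ℤ) → W) : (Fin N' → ℤ) → W :=
  fun k => ∑ᶠ m : ℤ, F (splitIdx π u v k m)

variable {π : Fin N → Fin N'} {u v : Fin N}

lemma splitIdx_left (k : Fin N' → ℤ) (m : ℤ) : splitIdx π u v k m u = m := by simp [splitIdx]

lemma splitIdx_right (huv : u ≠ v) (k : Fin N' → ℤ) (m : ℤ) :
    splitIdx π u v k m v = k (π v) - m := by simp [splitIdx, huv.symm]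

lemma splitIdx_of_ne {i : Fin N} (hu : i ≠ u) (hv : i ≠ v) (k : Fin N' → ℤ) (m : ℤ) :
    splitIdx π u v k m i = k (π i) := by simp [splitIdx, hu, hv]

lemma finite_support_splitIdx (huv : u ≠ v) {F : (Fin N → ℤ) → W}
    (hF : F ∈ laurentPairSubmodule W u v) (k : Fin N' → ℤ) :
    (Function.support fun m : ℤ => F (splitIdx π u v k m)).Finite := by
  obtain ⟨A, hA⟩ := hF (splitIdx π u v k 0)
  refine (Set.finite_Icc A (k (π v) - A)).subset fun m hm => ?_
  by_contra h
  refine hm (hA _ (fun i hu hv => by rw [splitIdx_of_ne hu hv, splitIdx_of_ne hu hv]) ?_)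
  rw [splitIdx_left, splitIdx_right huv]
  simp only [Set.mem_Icc, not_and_or, not_le] at h
  omega

lemma mergeFam_mulPolyN (h : IsMerge π u v) (P : MvPolynomial (Fin N) ℂ) {F : (Fin N → ℤ) → W}
    (hF : F ∈ laurentPairSubmodule W u v) :
    mergeFam π u v (mulPolyN P F) = mulPolyN (MvPolynomial.rename π P) (mergeFam π u v F) := by
  refine map_mulPolyN π _ mulPolyN_X_mem_laurentPair (mergeFam π u v) ?_ ?_ ?_ P hF
  · intro F hF G hG
    funext k
    exact finsum_add_distrib (finite_support_splitIdx h.ne hF k) (finite_support_splitIdx h.ne hG k)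
  · intro c F hF
    funext k
    exact (smul_finsum' c (finite_support_splitIdx h.ne hF k)).symm
  · intro j F _
    funext k
    rw [mulPolyN_X]
    simp only [mergeFam, mulPolyN_X]
    have hne : ∀ i, i ≠ u → i ≠ v → π i ≠ π v := fun i hu hv hi => hv (h.inj i v hi hu hv)
    by_cases hu : j = u
    · subst hu
      rw [← finsum_comp_equiv (Equiv.addRight (1 : ℤ))]
      refine finsum_congr fun m => congrArg F (funext fun i => ?_)
      simp only [splitIdx, Pi.sub_apply, Equiv.coe_addRight, Pi.single_apply]
      by_cases hi : i = j
      · simp [hi]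
      by_cases hv : i = v
      · subst hv; simp [hi, h.map_eq]; ring
      · have := hne i hi hv
        simp [hi, hv, h.map_eq, this]
    · refine finsum_congr fun m => congrArg F (funext fun i => ?_)
      simp only [splitIdx, Pi.sub_apply, Pi.single_apply]
      by_cases hi : i = u
      · simp [hi, Ne.symm hu]
      by_cases hv : i = v
      · subst hv
        by_cases hj : i = j
        · subst hj; simp [hi]; ring
        · simp [hi, hj, Ne.symm (hne j hu (Ne.symm hj))]
      · have : π i = π j ↔ i = j := ⟨fun hij => h.inj i j hij hi hv, fun hij => by rw [hij]⟩
        simp [hi, hv, this]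

lemma mergeFam_mem_laurentPair (h : IsMerge π u v) {F : (Fin N → ℤ) → W}
    (hF : F ∈ laurentPairSubmodule W u v) :
    mergeFam π u v F ∈ laurentPairSubmodule W (π v) (π v) := by
  intro k
  obtain ⟨A, hA⟩ := hF (splitIdx π u v k 0)
  refine ⟨2 * A, fun l hl hlt => finsum_eq_zero_of_forall_eq_zero fun m => hA _ ?_ ?_⟩
  · intro i hu hv
    have hi : π i ≠ π v := fun hi => hv (h.inj i v hi hu hv)
    rw [splitIdx_of_ne hu hv, splitIdx_of_ne hu hv, hl _ hi hi]
  · rw [splitIdx_left, splitIdx_right h.ne]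
    omega

end Merge

lemma IsLaurentN.mergeFam {W : Type*} [AddCommGroup W] {N N' : ℕ} {π : Fin N → Fin N'}
    {u v : Fin N} (h : IsMerge π u v) {F : (Fin N → ℤ) → W} (hF : IsLaurentN F) :
    IsLaurentN (mergeFam π u v F) := by
  obtain ⟨A, hA⟩ := hF
  refine ⟨min A (2 * A), fun k ⟨i, hi⟩ => finsum_eq_zero_of_forall_eq_zero fun m => ?_⟩
  obtain ⟨j, rfl⟩ := h.surj i
  by_cases hj : π j = π v
  · rw [hj] at hi
    by_cases hm : m < A
    · exact hA _ ⟨u, by rwa [splitIdx_left]⟩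
    · exact hA _ ⟨v, by rw [splitIdx_right h.ne]; omega⟩
  · refine hA _ ⟨j, ?_⟩
    rw [splitIdx_of_ne (fun hu => hj (by rw [hu, h.map_eq])) (fun hv => hj (congrArg π hv))]
    omega

section LaurentSeriesAction

variable {W : Type*} [AddCommGroup W] [Module ℂ W] {N : ℕ}

/-- Multiplication of a family by the Laurent series `f(x_c)`. -/
def mulLC (f : LC) (c : Fin N) (F : (Fin N → ℤ) → W) : (Fin N → ℤ) → W :=
  fun k => ∑ᶠ t : ℤ, f.coeff t • F (k - Pi.single c t)

lemma exists_forall_lt_coeff_eq_zero {R : Type*} [Zero R] (f : HahnSeries ℤ R) :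
    ∃ o : ℤ, ∀ t < o, f.coeff t = 0 :=
  ⟨f.order, fun _ h => HahnSeries.coeff_eq_zero_of_lt_order h⟩

lemma finite_support_mulLC (f : LC) {c : Fin N} {F : (Fin N → ℤ) → W}
    (hF : F ∈ laurentPairSubmodule W c c) (k : Fin N → ℤ) :
    (Function.support fun t : ℤ => f.coeff t • F (k - Pi.single c t)).Finite := by
  obtain ⟨A, hA⟩ := hF k
  obtain ⟨o, ho⟩ := exists_forall_lt_coeff_eq_zero f
  refine (Set.finite_Icc o (k c - A)).subset fun t ht => ?_
  by_contra h
  simp only [Set.mem_Icc, not_and_or, not_le] at h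
  apply ht
  rcases h with h | h
  · simp only [ho t h, zero_smul]
  · simp only
    rw [hA _ (fun i hi _ => by simp [hi]) (by simp; omega), smul_zero]

lemma mulLC_mulPolyN (f : LC) {c : Fin N} (P : MvPolynomial (Fin N) ℂ) {F : (Fin N → ℤ) → W}
    (hF : F ∈ laurentPairSubmodule W c c) :
    mulLC f c (mulPolyN P F) = mulPolyN P (mulLC f c F) := by
  have := map_mulPolyN id _ mulPolyN_X_mem_laurentPair (mulLC f c) ?_ ?_ ?_ P hF
  · simpa using this
  · intro F hF G hG
    funext k
    simp only [mulLC, Pi.add_apply, smul_add]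
    exact finsum_add_distrib (finite_support_mulLC f hF k) (finite_support_mulLC f hG k)
  · intro a F hF
    funext k
    simp only [mulLC, Pi.smul_apply, smul_comm _ a]
    exact (smul_finsum' a (finite_support_mulLC f hF k)).symm
  · intro j F _
    funext k
    rw [mulPolyN_X]
    simp only [mulLC, mulPolyN_X, id, sub_right_comm]

lemma IsLaurentN.mulLC (f : LC) (c : Fin N) {F : (Fin N → ℤ) → W} (hF : IsLaurentN F) :
    IsLaurentN (mulLC f c F) := by
  obtain ⟨A, hA⟩ := hF
  obtain ⟨o, ho⟩ := exists_forall_lt_coeff_eq_zero f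
  refine ⟨min A (A + o), fun k ⟨i, hi⟩ => finsum_eq_zero_of_forall_eq_zero fun t => ?_⟩
  by_cases ht : t < o
  · rw [ho t ht, zero_smul]
  rw [hA _ ⟨i, ?_⟩, smul_zero]
  by_cases hc : i = c
  · subst hc; simp; omega
  · simp [hc]; omega

end LaurentSeriesAction

section Sequences

variable {W : Type*} [AddCommGroup W] [Module ℂ W]

lemma isLinearMap_seqCoeff {r : ℕ} (ψ : Fin r → EW W) (k : Fin r → ℤ) :
    IsLinearMap ℂ fun w => seqCoeff ψ w k := by
  induction r with
  | zero => exact ⟨fun _ _ => rfl, fun _ _ => rfl⟩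
  | succ r ih =>
    have h := ih (Fin.tail ψ) (Fin.tail k)
    constructor
    · intro x y
      simp only [seqCoeff, mf, h.map_add, map_add, Pi.add_apply]
    · intro c x
      simp only [seqCoeff, mf, h.map_smul, map_smul, Pi.smul_apply]

/-- `seqCoeff` as a linear map. -/
def seqCoeffLin {r : ℕ} (ψ : Fin r → EW W) (k : Fin r → ℤ) : W →ₗ[ℂ] W :=
  (isLinearMap_seqCoeff ψ k).mk'

lemma seqCoeffLin_apply {r : ℕ} (ψ : Fin r → EW W) (k : Fin r → ℤ) (w : W) :
    seqCoeffLin ψ k w = seqCoeff ψ w k := rfl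

lemma seqCoeff_concat {r s n : ℕ} (hn : n = r + s) (ψ : Fin r → EW W) (φ : Fin s → EW W)
    (χ : Fin n → EW W) (hψ : ∀ i : Fin r, χ ⟨i, by omega⟩ = ψ i)
    (hφ : ∀ i : Fin s, χ ⟨r + i, by omega⟩ = φ i) (w : W) (k : Fin n → ℤ) :
    seqCoeff χ w k =
      seqCoeff ψ (seqCoeff φ w fun i => k ⟨r + i, by omega⟩) fun i => k ⟨i, by omega⟩ := by
  induction r generalizing n with
  | zero =>
    obtain rfl : n = s := by omega
    have hχ : χ = φ := funext fun i => by simpa using hφ i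
    subst hχ
    simp [seqCoeff]
  | succ r ih =>
    obtain ⟨n, rfl⟩ : ∃ n', n = n' + 1 := ⟨r + s, by omega⟩
    have h := ih (by omega) (Fin.tail ψ) (Fin.tail χ) (fun i => hψ i.succ)
      (fun i => by rw [← hφ i]; exact congrArg χ (Fin.ext (by simp; omega))) (Fin.tail k)
    have hidx : (fun i : Fin s => Fin.tail k ⟨r + i, by omega⟩) =
        fun i : Fin s => k ⟨r + 1 + i, by omega⟩ :=
      funext fun i => congrArg k (Fin.ext (by simp; omega))
    rw [hidx] at h
    rw [seqCoeff, h, seqCoeff]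
    congr 1
    exact hψ 0

lemma seqCoeff_append {r s : ℕ} (ψ : Fin r → EW W) (φ : Fin s → EW W) (w : W)
    (k : Fin (r + s) → ℤ) :
    seqCoeff (Fin.append ψ φ) w k =
      seqCoeff ψ (seqCoeff φ w fun i => k (Fin.natAdd r i)) fun i => k (Fin.castAdd s i) :=
  seqCoeff_concat rfl ψ φ _ (Fin.append_left ψ φ) (Fin.append_right ψ φ) w k

lemma pairPoly_pow (q : MvPolynomial (Fin 2) ℂ) (M r : ℕ) :
    pairPoly (q ^ M) r = pairPoly q r ^ M := by
  simp [pairPoly, Finset.prod_pow]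

end Sequences

section Sandwich

variable {W : Type*} [AddCommGroup W] [Module ℂ W] {r s : ℕ}

/-- The position of `a` in `(ψ₁,…,ψ_r,a,b,φ₁,…,φ_s)`. -/
def posLeft (r s : ℕ) : Fin (r + 2 + s) := Fin.castAdd s (Fin.natAdd r 0)

/-- The position of `b` in `(ψ₁,…,ψ_r,a,b,φ₁,…,φ_s)`. -/
def posRight (r s : ℕ) : Fin (r + 2 + s) := Fin.castAdd s (Fin.natAdd r 1)

/-- The position of `c` in `(ψ₁,…,ψ_r,c,φ₁,…,φ_s)`. -/
def posMid (r s : ℕ) : Fin (r + 1 + s) := Fin.castAdd s (Fin.natAdd r 0)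

/-- The map identifying the positions of `a` and `b`. -/
def collapse (r s : ℕ) (i : Fin (r + 2 + s)) : Fin (r + 1 + s) :=
  ⟨if (i : ℕ) ≤ r then i else i - 1, by have := i.2; split_ifs <;> omega⟩

@[simp] lemma val_posLeft : (posLeft r s : ℕ) = r := by simp [posLeft]
@[simp] lemma val_posRight : (posRight r s : ℕ) = r + 1 := by simp [posRight]
@[simp] lemma val_posMid : (posMid r s : ℕ) = r := by simp [posMid]

lemma collapse_posRight : collapse r s (posRight r s) = posMid r s :=
  Fin.ext (by simp [collapse])

lemma isMerge_collapse : IsMerge (collapse r s) (posLeft r s) (posRight r s) where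
  ne h := by simpa using congrArg Fin.val h
  map_eq := Fin.ext (by simp [collapse])
  inj i j h hu hv := by
    have h' := congrArg Fin.val h
    simp only [collapse, ne_eq, Fin.ext_iff, val_posLeft, val_posRight] at h' hu hv ⊢
    split_ifs at h' <;> omega
  surj i := by
    by_cases hi : (i : ℕ) ≤ r
    · exact ⟨⟨i, by omega⟩, Fin.ext (by simp [collapse, hi])⟩
    · exact ⟨⟨i + 1, by omega⟩, Fin.ext (by simp [collapse]; omega)⟩

lemma collapse_lt_collapse {i j : Fin (r + 2 + s)} (hij : i < j)
    (h : (i, j) ≠ (posLeft r s, posRight r s)) : collapse r s i < collapse r s j := by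
  simp only [collapse, ne_eq, Prod.mk.injEq, Fin.ext_iff, val_posLeft, val_posRight,
    Fin.lt_def] at h hij ⊢
  split_ifs <;> omega

/-- The product of `q(x_i,x_j)` over all pairs `i < j` except the pair of the positions of `a`
and `b`. -/
def pairPolyErase (q : MvPolynomial (Fin 2) ℂ) (r s : ℕ) : MvPolynomial (Fin (r + 2 + s)) ℂ :=
  ∏ ij ∈ (Finset.univ.filter
      (fun ij : Fin (r + 2 + s) × Fin (r + 2 + s) => ij.1 < ij.2)).erase
        (posLeft r s, posRight r s),
    MvPolynomial.rename ![ij.1, ij.2] q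

lemma pairPoly_eq_mul_pairPolyErase (q : MvPolynomial (Fin 2) ℂ) :
    pairPoly q (r + 2 + s) =
      MvPolynomial.rename ![posLeft r s, posRight r s] q * pairPolyErase q r s := by
  refine (Finset.mul_prod_erase _ (fun ij : Fin (r + 2 + s) × Fin (r + 2 + s) =>
    MvPolynomial.rename ![ij.1, ij.2] q) (a := (posLeft r s, posRight r s)) ?_).symm
  rw [Finset.mem_filter]
  refine ⟨Finset.mem_univ _, ?_⟩
  change (posLeft r s : ℕ) < posRight r s
  simp

lemma exists_rename_pairPolyErase_dvd (q : MvPolynomial (Fin 2) ℂ) (r s : ℕ) :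
    ∃ C : ℕ, MvPolynomial.rename (collapse r s) (pairPolyErase q r s) ∣
      pairPoly q (r + 1 + s) ^ C := by
  rw [pairPolyErase, map_prod]
  refine ⟨_, (Finset.prod_dvd_prod_of_dvd _ (fun _ => pairPoly q (r + 1 + s)) ?_).trans
    (dvd_of_eq (Finset.prod_const _))⟩
  rintro ⟨i, j⟩ hij
  rw [Finset.mem_erase, Finset.mem_filter] at hij
  rw [MvPolynomial.rename_rename]
  have hcomp : collapse r s ∘ ![i, j] = ![collapse r s i, collapse r s j] := by
    funext x
    fin_cases x <;> rfl
  simp only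
  rw [hcomp]
  exact Finset.dvd_prod_of_mem (fun ij : Fin (r + 1 + s) × Fin (r + 1 + s) =>
    MvPolynomial.rename ![ij.1, ij.2] q) (a := (collapse r s i, collapse r s j))
    (by simpa using collapse_lt_collapse hij.2.2 hij.1)

/-- The family `ψ₁(y₁) ⋯ ψ_r(y_r) G(x₁,x₂) φ₁(z₁) ⋯ φ_s(z_s) w`. -/
def sandwich (ψ : Fin r → EW W) (φ : Fin s → EW W) (w : W) (G : W → ℤ → ℤ → W) :
    (Fin (r + 2 + s) → ℤ) → W := fun k =>
  seqCoeff ψ (G (seqCoeff φ w fun i => k (Fin.natAdd (r + 2) i))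
    (k (posLeft r s)) (k (posRight r s))) fun i => k (Fin.castAdd s (Fin.castAdd 2 i))

lemma seqCoeff_append_pair (ψ : Fin r → EW W) (φ : Fin s → EW W) (a b : EW W) (w : W) :
    seqCoeff (Fin.append (Fin.append ψ ![a, b]) φ) w = sandwich ψ φ w (Fab a b) := by
  funext k
  rw [seqCoeff_append, seqCoeff_append]
  rfl

lemma seqCoeff_append_single (ψ : Fin r → EW W) (φ : Fin s → EW W) (c : EW W) (w : W)
    (k : Fin (r + 1 + s) → ℤ) :
    seqCoeff (Fin.append (Fin.append ψ ![c]) φ) w k =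
      seqCoeff ψ (mf c (seqCoeff φ w fun i => k (Fin.natAdd (r + 1) i)) (-k (posMid r s) - 1))
        fun i => k (Fin.castAdd s (Fin.castAdd 1 i)) := by
  rw [seqCoeff_append, seqCoeff_append]
  rfl

lemma castAdd_castAdd_ne (i : Fin r) : Fin.castAdd s (Fin.castAdd 2 i) ≠ posLeft r s ∧
    Fin.castAdd s (Fin.castAdd 2 i) ≠ posRight r s ∧
    Fin.castAdd s (Fin.castAdd 1 i) ≠ posMid r s := by
  simp only [ne_eq, Fin.ext_iff, val_posLeft, val_posRight, val_posMid, Fin.val_castAdd]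
  omega

lemma natAdd_ne (i : Fin s) : Fin.natAdd (r + 2) i ≠ posLeft r s ∧
    Fin.natAdd (r + 2) i ≠ posRight r s ∧ Fin.natAdd (r + 1) i ≠ posMid r s := by
  simp only [ne_eq, Fin.ext_iff, val_posLeft, val_posRight, val_posMid, Fin.val_natAdd]
  omega

lemma collapse_castAdd_castAdd (i : Fin r) :
    collapse r s (Fin.castAdd s (Fin.castAdd 2 i)) = Fin.castAdd s (Fin.castAdd 1 i) :=
  Fin.ext (by simp only [collapse, Fin.val_castAdd]; split_ifs <;> omega)

lemma collapse_natAdd (i : Fin s) :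
    collapse r s (Fin.natAdd (r + 2) i) = Fin.natAdd (r + 1) i :=
  Fin.ext (by simp only [collapse, Fin.val_natAdd]; split_ifs <;> omega)

lemma mapDomain_pair_of_ne {N : ℕ} {u v i : Fin N} (d : Fin 2 →₀ ℕ) (hu : i ≠ u) (hv : i ≠ v) :
    d.mapDomain ![u, v] i = 0 := by
  refine Finsupp.mapDomain_of_notMem_range _ _ ?_
  rintro ⟨x, hx⟩
  fin_cases x
  · exact hu hx.symm
  · exact hv hx.symm

lemma pair_injective {N : ℕ} {u v : Fin N} (huv : u ≠ v) :
    Function.Injective ![u, v] := by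
  intro x y hxy
  fin_cases x <;> fin_cases y <;> simp_all

lemma sandwich_mulPoly (ψ : Fin r → EW W) (φ : Fin s → EW W) (w : W) (G : W → ℤ → ℤ → W)
    (p : MvPolynomial (Fin 2) ℂ) :
    sandwich ψ φ w (fun w => mulPoly p (G w)) =
      mulPolyN (MvPolynomial.rename ![posLeft r s, posRight r s] p) (sandwich ψ φ w G) := by
  funext k
  have hinj := pair_injective (isMerge_collapse (r := r) (s := s)).ne
  rw [mulPolyN_rename]
  simp only [sandwich, mulPoly]
  rw [← seqCoeffLin_apply, map_sum]
  refine Finset.sum_congr rfl fun d _ => ?_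
  have h₀ : d.mapDomain ![posLeft r s, posRight r s] (posLeft r s) = d 0 :=
    Finsupp.mapDomain_apply hinj d 0
  have h₁ : d.mapDomain ![posLeft r s, posRight r s] (posRight r s) = d 1 :=
    Finsupp.mapDomain_apply hinj d 1
  rw [map_smul, seqCoeffLin_apply, h₀, h₁]
  simp only [mapDomain_pair_of_ne d (castAdd_castAdd_ne _).1 (castAdd_castAdd_ne _).2.1,
    mapDomain_pair_of_ne d (natAdd_ne _).1 (natAdd_ne _).2.1, Nat.cast_zero, sub_zero]

lemma sandwich_mem_laurentPair (ψ : Fin r → EW W) (φ : Fin s → EW W) (w : W)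
    {G : W → ℤ → ℤ → W} (hG : ∀ w, IsLaurent2 (G w)) :
    sandwich ψ φ w G ∈ laurentPairSubmodule W (posLeft r s) (posRight r s) := by
  intro k
  obtain ⟨A, hA⟩ := hG (seqCoeff φ w fun i => k (Fin.natAdd (r + 2) i))
  refine ⟨A, fun l hl h => ?_⟩
  have hφ : (fun i => l (Fin.natAdd (r + 2) i)) = fun i => k (Fin.natAdd (r + 2) i) :=
    funext fun i => hl _ (natAdd_ne i).1 (natAdd_ne i).2.1
  rw [sandwich, hφ, hA _ _ h, ← seqCoeffLin_apply, map_zero]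

end Sandwich

section VertexOperation

variable {W : Type*} [AddCommGroup W] [Module ℂ W] {r s : ℕ}

lemma finite_support_substYE {G : ℤ → ℤ → W} (hG : IsLaurent2 G) (c : ℤ → ℂ) (j t : ℤ) :
    (Function.support fun m : ℤ => c m • G m (t - m + j)).Finite := by
  obtain ⟨A, hA⟩ := hG
  refine (Set.finite_Icc A (t + j - A)).subset fun m hm => ?_
  by_contra h
  simp only [Set.mem_Icc, not_and_or, not_le] at h
  refine hm ?_
  simp only
  rw [hA _ _ (by omega), smul_zero]

lemma exists_forall_lt_substYE_eq_zero {p : MvPolynomial (Fin 2) ℂ} {a b : EW W} {w : W}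
    (hG : IsLaurent2 (mulPoly p (Fab a b w))) (α : ℂ) (j : ℕ) :
    ∃ B : ℤ, ∀ t < B, substYE α p a b w j t = 0 := by
  obtain ⟨A, hA⟩ := hG
  refine ⟨2 * A - j, fun t ht => finsum_eq_zero_of_forall_eq_zero fun m => ?_⟩
  rw [hA _ _ (by omega), smul_zero]

lemma finite_support_fullYE {p : MvPolynomial (Fin 2) ℂ} {a b : EW W} {w : W}
    (hG : IsLaurent2 (mulPoly p (Fab a b w))) (α : ℂ) (f : LC) (j : ℕ) (T : ℤ) :
    (Function.support fun t : ℤ => f.coeff t • substYE α p a b w j (T - t)).Finite := by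
  obtain ⟨B, hB⟩ := exists_forall_lt_substYE_eq_zero hG α j
  obtain ⟨o, ho⟩ := exists_forall_lt_coeff_eq_zero f
  refine (Set.finite_Icc o (T - B)).subset fun t ht => ?_
  by_contra h
  simp only [Set.mem_Icc, not_and_or, not_le] at h
  apply ht
  rcases h with h | h
  · simp only [ho t h, zero_smul]
  · simp only [hB (T - t) (by omega), smul_zero]

lemma fullYE_eq_sum {p : MvPolynomial (Fin 2) ℂ} {a b : EW W} {w : W}
    (hG : IsLaurent2 (mulPoly p (Fab a b w))) {α : ℂ} {o : ℤ}
    (ho : ∀ i < o, (qInv p α).coeff i = 0) (J T : ℤ) :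
    fullYE α p a b w J T = ∑ i ∈ Finset.Icc o J,
      ∑ᶠ t : ℤ, ((qInv p α).coeff i).coeff t • substYE α p a b w (J - i).toNat (T - t) := by
  have hzero : ∀ i, i ∉ Finset.Icc o J → ∀ t, ((qInv p α).coeff i).coeff t •
      (if 0 ≤ J - i then substYE α p a b w (J - i).toNat (T - t) else 0) = 0 := by
    intro i hi t
    simp only [Finset.mem_Icc, not_and_or, not_le] at hi
    rcases hi with h | h
    · rw [ho i h, HahnSeries.coeff_zero, zero_smul]
    · rw [if_neg (by omega), smul_zero]
  have hfin : (Function.support fun i : ℤ × ℤ => ((qInv p α).coeff i.1).coeff i.2 •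
      (if 0 ≤ J - i.1 then substYE α p a b w (J - i.1).toNat (T - i.2) else 0)).Finite := by
    refine ((Set.finite_Icc o J).biUnion fun i _ => (Set.finite_singleton i).prod
      (finite_support_fullYE hG α ((qInv p α).coeff i) (J - i).toNat T)).subset ?_
    rintro ⟨i, t⟩ hit
    rw [Function.mem_support] at hit
    have hi : i ∈ Finset.Icc o J := by
      by_contra h
      exact hit (hzero i h t)
    have hJ : 0 ≤ J - i := by rw [Finset.mem_Icc] at hi; omega
    simp only [if_pos hJ] at hit
    simp only [Set.mem_iUnion]
    exact ⟨i, Finset.mem_Icc.mp hi, rfl, hit⟩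
  rw [fullYE, finsum_curry _ hfin, finsum_eq_sum_of_support_subset (s := Finset.Icc o J)]
  · refine Finset.sum_congr rfl fun i hi => finsum_congr fun t => ?_
    rw [if_pos (by rw [Finset.mem_Icc] at hi; omega)]
  · intro i hi
    by_contra h
    exact hi (finsum_eq_zero_of_forall_eq_zero (hzero i h))

/-- The substitution `x₁ = x` in the divided derivative `∂₁^{(j)}` of a sandwiched family gives the
coefficient of `x₀^j` after the substitution `x₁ = x + x₀`. -/
lemma seqCoeff_substYE (ψ : Fin r → EW W) (φ : Fin s → EW W) (w : W)
    {p : MvPolynomial (Fin 2) ℂ} {a b : EW W} (hG : ∀ w, IsLaurent2 (mulPoly p (Fab a b w)))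
    (j : ℕ) (k : Fin (r + 1 + s) → ℤ) :
    seqCoeff ψ (substYE 1 p a b (seqCoeff φ w fun i => k (Fin.natAdd (r + 1) i)) j
        (k (posMid r s))) (fun i => k (Fin.castAdd s (Fin.castAdd 1 i))) =
      ((j.factorial : ℂ)⁻¹ • mergeFam (collapse r s) (posLeft r s) (posRight r s)
        ((partialFam (posLeft r s))^[j]
          (sandwich ψ φ w fun w => mulPoly p (Fab a b w)))) k := by
  have hne := (isMerge_collapse (r := r) (s := s)).ne
  rw [substYE, ← seqCoeffLin_apply]
  refine ((seqCoeffLin ψ _).toAddMonoidHom.map_finsum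
    (finite_support_substYE (hG _) _ _ _)).trans ?_
  rw [Pi.smul_apply, mergeFam, smul_finsum' _ (finite_support_splitIdx hne
    (iterate_partialFam_mem_laurentPair hne (sandwich_mem_laurentPair ψ φ w hG) j) k),
    ← finsum_comp_equiv (Equiv.addRight (j : ℤ))]
  refine finsum_congr fun m => ?_
  rw [iterate_partialFam, smul_smul, Equiv.coe_addRight]
  simp only [LinearMap.toAddMonoidHom_coe, map_smul, seqCoeffLin_apply, one_zpow, mul_one]
  congr 1
  · rw [splitIdx_left, binom, div_eq_inv_mul]
    push_cast
    rfl
  · simp only [sandwich, Pi.add_apply, splitIdx_left, splitIdx_right hne, Pi.single_eq_same,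
      Pi.single_eq_of_ne hne.symm, Pi.single_eq_of_ne (castAdd_castAdd_ne _).1,
      Pi.single_eq_of_ne (natAdd_ne _).1, add_zero,
      splitIdx_of_ne (castAdd_castAdd_ne _).1 (castAdd_castAdd_ne _).2.1,
      splitIdx_of_ne (natAdd_ne _).1 (natAdd_ne _).2.1, collapse_castAdd_castAdd,
      collapse_natAdd, collapse_posRight]
    congr 2
    ring

lemma seqCoeff_fullYE (ψ : Fin r → EW W) (φ : Fin s → EW W) (w : W)
    {p : MvPolynomial (Fin 2) ℂ} {a b : EW W} (hG : ∀ w, IsLaurent2 (mulPoly p (Fab a b w)))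
    {o : ℤ} (ho : ∀ i < o, (qInv p 1).coeff i = 0) (J : ℤ) (k : Fin (r + 1 + s) → ℤ) :
    seqCoeff ψ (fullYE 1 p a b (seqCoeff φ w fun i => k (Fin.natAdd (r + 1) i)) J
        (k (posMid r s))) (fun i => k (Fin.castAdd s (Fin.castAdd 1 i))) =
      (∑ i ∈ Finset.Icc o J, mulLC ((qInv p 1).coeff i) (posMid r s)
        (((J - i).toNat.factorial : ℂ)⁻¹ •
          mergeFam (collapse r s) (posLeft r s) (posRight r s)
            ((partialFam (posLeft r s))^[(J - i).toNat]
              (sandwich ψ φ w fun w => mulPoly p (Fab a b w))))) k := by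
  rw [fullYE_eq_sum (hG _) ho, ← seqCoeffLin_apply, map_sum, Finset.sum_apply]
  refine Finset.sum_congr rfl fun i _ => ?_
  refine ((seqCoeffLin ψ _).toAddMonoidHom.map_finsum
    (finite_support_fullYE (hG _) _ _ _ _)).trans (finsum_congr fun t => ?_)
  rw [← seqCoeff_substYE ψ φ w hG]
  simp only [LinearMap.toAddMonoidHom_coe, map_smul, seqCoeffLin_apply, Pi.sub_apply,
    Pi.single_eq_same, Pi.single_eq_of_ne (castAdd_castAdd_ne _).2.2,
    Pi.single_eq_of_ne (natAdd_ne _).2.2, sub_zero]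

lemma isLaurentN_pairPolyErase_sandwich (ψ : Fin r → EW W) (φ : Fin s → EW W) (w : W)
    {p q : MvPolynomial (Fin 2) ℂ} (hq : q ≠ 0) {a b : EW W}
    (hG : ∀ w, IsLaurent2 (mulPoly p (Fab a b w)))
    (hseq : IsLaurentN (mulPolyN (pairPoly q (r + 2 + s)) (sandwich ψ φ w (Fab a b)))) :
    IsLaurentN (mulPolyN (pairPolyErase q r s)
      (sandwich ψ φ w fun w => mulPoly p (Fab a b w))) := by
  have hinj := pair_injective (isMerge_collapse (r := r) (s := s)).ne
  refine IsLaurentN.of_mulPolyN (u := posLeft r s) (v := posRight r s)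
    (P := MvPolynomial.rename ![posLeft r s, posRight r s] q) ?_ ?_
    (mulPolyN_mem_laurentPair _ (sandwich_mem_laurentPair ψ φ w hG)) ?_
  · exact (map_ne_zero_iff _ (MvPolynomial.rename_injective _ hinj)).mpr hq
  · intro d hd i hu hv
    obtain ⟨e, rfl, -⟩ := MvPolynomial.coeff_rename_ne_zero _ _ _
      (MvPolynomial.mem_support_iff.mp hd)
    exact mapDomain_pair_of_ne e hu hv
  · rw [sandwich_mulPoly, ← mulPolyN_mul, ← mulPolyN_mul, ← pairPoly_eq_mul_pairPolyErase,
      mul_comm, mulPolyN_mul]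
    exact hseq.mulPolyN _

lemma isLaurentN_mulPolyN_fullYE (ψ : Fin r → EW W) (φ : Fin s → EW W) (w : W)
    {p q : MvPolynomial (Fin 2) ℂ} (hq : q ≠ 0) {a b : EW W}
    (hG : ∀ w, IsLaurent2 (mulPoly p (Fab a b w)))
    (hseq : IsLaurentN (mulPolyN (pairPoly q (r + 2 + s)) (sandwich ψ φ w (Fab a b))))
    {C : ℕ} (hC : MvPolynomial.rename (collapse r s) (pairPolyErase q r s) ∣
      pairPoly q (r + 1 + s) ^ C)
    {o : ℤ} (ho : ∀ i < o, (qInv p 1).coeff i = 0) (J : ℤ) :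
    IsLaurentN (mulPolyN (pairPoly (q ^ (C * ((J - o).toNat + 1))) (r + 1 + s))
      fun k => seqCoeff ψ (fullYE 1 p a b (seqCoeff φ w fun i => k (Fin.natAdd (r + 1) i)) J
        (k (posMid r s))) fun i => k (Fin.castAdd s (Fin.castAdd 1 i))) := by
  have hM := isMerge_collapse (r := r) (s := s)
  have hmem := sandwich_mem_laurentPair ψ φ w hG
  have hL := isLaurentN_pairPolyErase_sandwich ψ φ w hq hG hseq
  rw [funext (seqCoeff_fullYE ψ φ w hG ho J), mulPolyN_sum_right]
  refine (laurentSubmodule W _).sum_mem fun i hi => ?_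
  set j := (J - i).toNat
  set F := (partialFam (posLeft r s))^[j] (sandwich ψ φ w fun w => mulPoly p (Fab a b w))
  have hF : F ∈ laurentPairSubmodule W (posLeft r s) (posRight r s) :=
    iterate_partialFam_mem_laurentPair hM.ne hmem j
  have hj : j ≤ (J - o).toNat := by rw [Finset.mem_Icc] at hi; omega
  obtain ⟨U, hU⟩ := (pow_dvd_pow (MvPolynomial.rename (collapse r s) (pairPolyErase q r s))
    (Nat.succ_le_succ hj)).trans (pow_dvd_pow_of_dvd hC ((J - o).toNat + 1))
  rw [pairPoly_pow, pow_mul, hU, mul_comm, ← map_pow, ← mulLC_mulPolyN, mulPolyN_smul_right,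
    mulPolyN_mul, ← mergeFam_mulPolyN hM _ hF]
  · refine IsLaurentN.mulLC _ _ ((laurentSubmodule W _).smul_mem _ (IsLaurentN.mulPolyN ?_ _))
    exact (isLaurentN_pow_mulPolyN_iterate_partialFam _ hL j).mergeFam hM
  · refine (laurentPairSubmodule W _ _).smul_mem _ ?_
    rw [← collapse_posRight]
    exact mergeFam_mem_laurentPair hM hF

lemma mf_YE_or_eq_zero {a b : EW W} (hab : QCPair a b) (n : ℤ) :
    YE a b n = 0 ∨
      ∀ w m, mf (YE a b n) w m = fullYE 1 hab.choose a b w (-n - 1) (-m - 1) := by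
  unfold YE YEa
  split_ifs with h
  · refine Or.inr fun w m => ?_
    rw [h.choose_spec w m, rawYE, dif_pos hab, Units.val_one]
  · exact Or.inl rfl

end VertexOperation

/-- cf. Proposition 2.11 / `pgeneratingcomplicatedone`.  If the
pair `(a(x), b(x))` and the sequence `(ψ₁(x),…,ψ_r(x), a(x), b(x), φ₁(x),…,φ_s(x))`
are quasi compatible, then for every `n ∈ ℤ` the sequence
`(ψ₁(x),…,ψ_r(x), a(x)ₙ b(x), φ₁(x),…,φ_s(x))` is quasi compatible. -/
theorem statement7 {W : Type*} [AddCommGroup W] [Module ℂ W] {r s : ℕ}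
    (ψ : Fin r → EW W) (φ : Fin s → EW W) (a b : EW W)
    (hab : QCPair a b)
    (hseq : QCSeq (Fin.append (Fin.append ψ ![a, b]) φ))
    (n : ℤ) :
    QCSeq (Fin.append (Fin.append ψ ![YE a b n]) φ) := by
  obtain ⟨q, hq, hlaurent⟩ := hseq
  rcases mf_YE_or_eq_zero hab n with h | h
  · refine ⟨1, one_ne_zero, fun w => ⟨0, fun k _ => ?_⟩⟩
    have hzero : seqCoeff (Fin.append (Fin.append ψ ![YE a b n]) φ) w = 0 := by
      funext k
      rw [seqCoeff_append_single, h]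
      exact (isLinearMap_seqCoeff ψ _).map_zero
    rw [hzero]
    simp [mulPolyN]
  · obtain ⟨C, hC⟩ := exists_rename_pairPolyErase_dvd q r s
    obtain ⟨o, ho⟩ := exists_forall_lt_coeff_eq_zero (qInv hab.choose 1)
    refine ⟨q ^ (C * ((-n - 1 - o).toNat + 1)), pow_ne_zero _ hq, fun w => ?_⟩
    have hseq := hlaurent w
    rw [seqCoeff_append_pair] at hseq
    convert isLaurentN_mulPolyN_fullYE ψ φ w hq hab.choose_spec.2 hseq hC ho (-n - 1) using 2
    funext k
    rw [seqCoeff_append_single, h]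
    congr 2
    ring

end NVA
end
end
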